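/- arXiv:2306.14041 — 4 statements merged into one kernel-verified Lean document; each statement's English description precedes it below -/
import Mathlib

section
/- Let Σ ⊂ ℝ^d be a set with cardinality |Σ| ≥ 2 and let ĉ~ : X × P(Σ) → ℝ be a measurable predictor satisfying ĉ~(x,P_N) ≤ esssup_{ξ∼P_N} ℓ(x,ξ) for every empirical distribution P_N. If x ∈ X satisfies inf_{ξ∈Σ} ℓ(x,ξ) < sup_{ξ∈Σ} ℓ(x,ξ), then sup_{P∈P(Σ)} limsup_{N→∞} (1/N) log Pr(c(x,P) > ĉ~(x,P_N)) = 0. -/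
open MeasureTheory Set Filter Metric Topology
open scoped ENNReal NNReal

set_option linter.unusedSectionVars false

noncomputable section

namespace Dro

variable {Ω : Type*} [MeasurableSpace Ω] [NormedAddCommGroup Ω] [BorelSpace Ω]
variable {X : Type*}

/-- The set of Borel probability measures supported on `S`. -/
def PMOn (S : Set Ω) : Set (ProbabilityMeasure Ω) := {μ | (μ : Measure Ω) S = 1}

/-- The expected loss `c(x, P) = E_P[ℓ(x, ξ)]`. -/
def cost (ℓ : X → Ω → ℝ) (x : X) (P : ProbabilityMeasure Ω) : ℝ :=
  ∫ ξ, ℓ x ξ ∂(P : Measure Ω)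

open Classical in
/-- Kullback–Leibler divergence `D_KL(μ, ν) = ∫ log (dμ/dν) dμ` if `μ ≪ ν`, `∞` otherwise. -/
def klDiv (μ ν : Measure Ω) : ℝ≥0∞ :=
  if μ ≪ ν ∧ Integrable (fun ξ => Real.log ((μ.rnDeriv ν ξ).toReal)) μ
  then ENNReal.ofReal (∫ ξ, Real.log ((μ.rnDeriv ν ξ).toReal) ∂μ)
  else ⊤

/-- 1-Wasserstein distance: infimum of `∫ ‖ξ' - ξ‖ dγ` over couplings `γ`. -/
def wdist (μ ν : Measure Ω) : ℝ≥0∞ :=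
  ⨅ (γ : Measure (Ω × Ω)) (_ : γ.map Prod.fst = μ) (_ : γ.map Prod.snd = ν),
    ∫⁻ p, edist p.1 p.2 ∂γ

/-- Lévy–Prokhorov distance. -/
def lpDist (μ ν : Measure Ω) : ℝ :=
  sInf {ε : ℝ | 0 < ε ∧ ∀ A : Set Ω, MeasurableSet A →
      (μ A ≤ ν (Metric.cthickening ε A) + ENNReal.ofReal ε ∧
       ν A ≤ μ (Metric.cthickening ε A) + ENNReal.ofReal ε)}

/-- Wasserstein-smoothed KL divergence `D^ε_{KL,W}(P', P)`. -/
def klSmoothW (S : Set Ω) (ε : ℝ) (P' P : ProbabilityMeasure Ω) : ℝ≥0∞ :=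
  ⨅ (Q : ProbabilityMeasure Ω) (_ : Q ∈ PMOn S ∧
      wdist (P' : Measure Ω) (Q : Measure Ω) ≤ ENNReal.ofReal ε),
    klDiv (Q : Measure Ω) (P : Measure Ω)

/-- Lévy-Prokhorov-smoothed KL divergence `D^ε_{KL,LP}(P', P)`. -/
def klSmoothLP (S : Set Ω) (ε : ℝ) (P' P : ProbabilityMeasure Ω) : ℝ≥0∞ :=
  ⨅ (Q : ProbabilityMeasure Ω) (_ : Q ∈ PMOn S ∧
      lpDist (P' : Measure Ω) (Q : Measure Ω) ≤ ε),
    klDiv (Q : Measure Ω) (P : Measure Ω)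

/-- The KL-DRO predictor `ĉ_{KL,r}`. -/
def cKL (S : Set Ω) (ℓ : X → Ω → ℝ) (r : ℝ) (x : X) (Phat : ProbabilityMeasure Ω) : ℝ :=
  sSup {v | ∃ P ∈ PMOn S,
    klDiv (Phat : Measure Ω) (P : Measure Ω) ≤ ENNReal.ofReal r ∧ v = cost ℓ x P}

/-- The Wasserstein-smoothed KL-DRO predictor `ĉ^ε_{KL,W,r}`. -/
def cKLW (S : Set Ω) (ℓ : X → Ω → ℝ) (ε r : ℝ) (x : X) (Phat : ProbabilityMeasure Ω) : ℝ :=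
  sSup {v | ∃ P ∈ PMOn S, klSmoothW S ε Phat P ≤ ENNReal.ofReal r ∧ v = cost ℓ x P}

/-- The LP-smoothed KL-DRO predictor `ĉ^ε_{KL,LP,r}`. -/
def cKLLP (S : Set Ω) (ℓ : X → Ω → ℝ) (ε r : ℝ) (x : X) (Phat : ProbabilityMeasure Ω) : ℝ :=
  sSup {v | ∃ P ∈ PMOn S, klSmoothLP S ε Phat P ≤ ENNReal.ofReal r ∧ v = cost ℓ x P}

/-- The empirical measure of samples `ω 0, …, ω (N-1)`. -/
def empMeas {N : ℕ} (ω : Fin N → Ω) : Measure Ω :=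
  (N : ℝ≥0∞)⁻¹ • ∑ i, Measure.dirac (ω i)

theorem empMeas_isProbability {N : ℕ} (hN : N ≠ 0) (ω : Fin N → Ω) :
    IsProbabilityMeasure (empMeas ω) := by
  constructor
  have h1 : (∑ i : Fin N, Measure.dirac (ω i)) (Set.univ : Set Ω) = N := by
    rw [Measure.finset_sum_apply]
    simp
  rw [empMeas, Measure.smul_apply, h1, smul_eq_mul, ENNReal.inv_mul_cancel]
  · exact_mod_cast hN
  · exact ENNReal.natCast_ne_top N

open Classical in
/-- The empirical distribution `P_N` as a probability measure (junk value for `N = 0`). -/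
def empPM (N : ℕ) (ω : Fin N → Ω) : ProbabilityMeasure Ω :=
  if h : N = 0 then ⟨Measure.dirac 0, by infer_instance⟩
  else ⟨empMeas ω, empMeas_isProbability h ω⟩

/-- The distribution of `N` i.i.d. samples from `P`. -/
def prodMeas (P : ProbabilityMeasure Ω) (N : ℕ) : Measure (Fin N → Ω) :=
  Measure.pi fun _ => (P : Measure Ω)

/-- The large-deviations rate `limsup_N (1/N) log Pr(E_N)` of a sequence of events. -/
def rate (P : ProbabilityMeasure Ω) (E : (N : ℕ) → Set (Fin N → Ω)) : EReal :=
  Filter.limsup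
    (fun N : ℕ => (((N : ℝ)⁻¹ : ℝ) : EReal) * ENNReal.log (prodMeas P N (E N))) Filter.atTop

/-- A predictor `ĉ` is uniformly feasible at rate `r`. -/
def UnifFeasible (S : Set Ω) (ℓ : X → Ω → ℝ) (chat : X → ProbabilityMeasure Ω → ℝ)
    (r : ℝ) : Prop :=
  ∀ P ∈ PMOn S,
    rate P (fun N => {ω | ∃ x, cost ℓ x P > chat x (empPM N ω)}) ≤ ((-r : ℝ) : EReal)

/-- A predictor `ĉ` is pointwise feasible at rate `r`. -/
def PtFeasible (S : Set Ω) (ℓ : X → Ω → ℝ) (chat : X → ProbabilityMeasure Ω → ℝ)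
    (r : ℝ) : Prop :=
  ∀ P ∈ PMOn S, ∀ x : X,
    rate P (fun N => {ω | cost ℓ x P > chat x (empPM N ω)}) ≤ ((-r : ℝ) : EReal)

end Dro
/-- ℝ^d with the Euclidean norm. -/
abbrev Euc (n : ℕ) := EuclideanSpace ℝ (Fin n)


theorem aux_rate_nonpos {Ω : Type*} [MeasurableSpace Ω] [NormedAddCommGroup Ω] [BorelSpace Ω]
    (P : ProbabilityMeasure Ω) (E : (N : ℕ) → Set (Fin N → Ω)) : Dro.rate P E ≤ 0 := by
  unfold Dro.rate
  refine Filter.limsup_le_of_le (h := Filter.Eventually.of_forall fun N => ?_)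
  have h1 : Dro.prodMeas P N (E N) ≤ 1 := by
    unfold Dro.prodMeas
    exact prob_le_one
  have h2 : ENNReal.log (Dro.prodMeas P N (E N)) ≤ 0 := by
    rw [← ENNReal.log_one]
    exact ENNReal.log_monotone h1
  refine mul_nonpos_of_nonneg_of_nonpos ?_ h2
  exact_mod_cast (by positivity : (0:ℝ) ≤ (N:ℝ)⁻¹)

theorem aux_rate_lower {Ω : Type*} [MeasurableSpace Ω] [NormedAddCommGroup Ω] [BorelSpace Ω]
    (P : ProbabilityMeasure Ω) (E : (N : ℕ) → Set (Fin N → Ω)) (a : Ω) (q : ℝ≥0∞)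
    (hq : q ≤ (P : Measure Ω) {a})
    (hE : ∀ N, 1 ≤ N → (fun _ => a) ∈ E N) : ENNReal.log q ≤ Dro.rate P E := by
  unfold Dro.rate
  refine Filter.le_limsup_of_frequently_le (Filter.Eventually.frequently ?_)
  filter_upwards [Filter.eventually_ge_atTop 1] with N hN
  have h1 : q ^ N ≤ Dro.prodMeas P N (E N) := by
    calc q ^ N ≤ ((P : Measure Ω) {a}) ^ N := by gcongr
      _ = Dro.prodMeas P N (Set.univ.pi fun _ => {a}) := by
          unfold Dro.prodMeas
          rw [Measure.pi_pi]
          simp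
      _ ≤ _ := by
          apply measure_mono
          intro ω hω
          have : ω = fun _ => a := by
            funext i
            simpa using hω i (Set.mem_univ i)
          rw [this]
          exact hE N hN
  have h2 := ENNReal.log_monotone h1
  rw [ENNReal.log_pow] at h2
  have h0 : (0:EReal) ≤ (((N:ℝ)⁻¹ : ℝ) : EReal) := by
    exact_mod_cast (by positivity : (0:ℝ) ≤ (N:ℝ)⁻¹)
  calc ENNReal.log q = (((N:ℝ)⁻¹ : ℝ) : EReal) * ((N:EReal) * ENNReal.log q) := by
        rw [← mul_assoc]
        have : (((N:ℝ)⁻¹ : ℝ) : EReal) * (N:EReal) = 1 := by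
          have hN' : (N:ℝ) ≠ 0 := by positivity
          have : (((N:ℝ)⁻¹ * (N:ℝ) : ℝ) : EReal) = 1 := by
            rw [inv_mul_cancel₀ hN']; rfl
          rw [← this, EReal.coe_mul]; rfl
        rw [this, one_mul]
    _ ≤ _ := mul_le_mul_of_nonneg_left h2 h0

open MeasureTheory in
/-- Theorem: Infeasibility of empirical DRO predictors.
Let `Σ ⊂ ℝ^d` have at least two points and let `ĉ~` be a predictor whose prediction at any
empirical distribution `P_N` (of samples lying in `Σ`) never exceeds the essential supremum
`esssup_{ξ∼P_N} ℓ(x,ξ)`.  If `x` satisfies `inf_{ξ∈Σ} ℓ(x,ξ) < sup_{ξ∈Σ} ℓ(x,ξ)`, then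
`sup_{P∈P(Σ)} limsup_N (1/N) log Pr(c(x,P) > ĉ~(x,P_N)) = 0`. -/
theorem empirical_predictors_infeasible
    {n : ℕ} {X : Type*} [Nonempty X]
    (S : Set (Euc n)) (hS : S.Nontrivial)
    (ℓ : X → Euc n → ℝ)
    (chat : X → ProbabilityMeasure (Euc n) → ℝ)
    (hemp : ∀ (x : X) (N : ℕ), 1 ≤ N → ∀ ω : Fin N → Euc n, (∀ i, ω i ∈ S) →
      chat x (Dro.empPM N ω) ≤ essSup (ℓ x) (Dro.empPM N ω : Measure (Euc n)))
    (x : X) (hx : ∃ ξa ∈ S, ∃ ξb ∈ S, ℓ x ξa < ℓ x ξb) :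
    (⨆ P ∈ Dro.PMOn S,
        Dro.rate P (fun N => {ω | Dro.cost ℓ x P > chat x (Dro.empPM N ω)})) = (0 : EReal) := by
  obtain ⟨a, ha, b, hb, hab⟩ := hx
  apply le_antisymm
  · exact iSup₂_le fun P _ => aux_rate_nonpos P _
  refine le_of_forall_lt fun c hc => ?_
  have hc1 : EReal.exp c < 1 := by
    rw [← EReal.exp_zero]
    exact EReal.exp_strictMono hc
  obtain ⟨q, hq1, hq2⟩ := exists_between hc1
  have hcq : c < ENNReal.log q := by
    rw [← EReal.log_exp c]
    exact ENNReal.log_strictMono hq1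
  have hqt : q ≠ ⊤ := (hq2.trans ENNReal.one_lt_top).ne
  have hpr : IsProbabilityMeasure (q • Measure.dirac a + (1 - q) • Measure.dirac b) := by
    constructor
    simp [add_tsub_cancel_of_le hq2.le]
  let P : ProbabilityMeasure (Euc n) := ⟨q • Measure.dirac a + (1 - q) • Measure.dirac b, hpr⟩
  have hPS : P ∈ Dro.PMOn S := by
    change (q • Measure.dirac a + (1 - q) • Measure.dirac b) S = 1
    simp [Measure.dirac_apply, ha, hb, add_tsub_cancel_of_le hq2.le]
  have hcost : ℓ x a < Dro.cost ℓ x P := by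
    change ℓ x a < ∫ ξ, ℓ x ξ ∂(q • Measure.dirac a + (1 - q) • Measure.dirac b)
    rw [integral_add_measure, integral_smul_measure, integral_smul_measure, integral_dirac,
      integral_dirac, ENNReal.toReal_sub_of_le hq2.le ENNReal.one_ne_top]
    · have : q.toReal < 1 := by
        rw [← ENNReal.toReal_one]
        exact (ENNReal.toReal_lt_toReal hqt ENNReal.one_ne_top).2 hq2
      simp only [smul_eq_mul, ENNReal.toReal_one]
      nlinarith
    · exact (integrable_dirac (by simp)).smul_measure hqt
    · exact (integrable_dirac (by simp)).smul_measure (ENNReal.sub_ne_top ENNReal.one_ne_top)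
  refine lt_of_lt_of_le (hcq.trans_le (aux_rate_lower P _ a q ?_ ?_))
    (le_iSup₂ (f := fun (P : ProbabilityMeasure (Euc n)) (_ : P ∈ Dro.PMOn S) =>
      Dro.rate P (fun N => {ω | Dro.cost ℓ x P > chat x (Dro.empPM N ω)})) P hPS)
  · change q ≤ (q • Measure.dirac a + (1 - q) • Measure.dirac b) {a}
    simp
  · intro N hN
    refine lt_of_le_of_lt (hemp x N hN (fun _ => a) (fun _ => ha)) ?_
    have hN0 : N ≠ 0 := by omega
    have he : ((Dro.empPM N (fun _ => a) : ProbabilityMeasure (Euc n)) : Measure (Euc n))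
        = Measure.dirac a := by
      have h0 : Dro.empPM N (fun _ => a) = (⟨Dro.empMeas (fun _ : Fin N => a),
          Dro.empMeas_isProbability hN0 _⟩ : ProbabilityMeasure (Euc n)) := by
        unfold Dro.empPM
        exact dif_neg hN0
      rw [h0]
      change Dro.empMeas (fun _ : Fin N => a) = _
      rw [Dro.empMeas, Finset.sum_const, Finset.card_univ, Fintype.card_fin,
        ← Nat.cast_smul_eq_nsmul ℝ≥0∞, smul_smul,
        ENNReal.inv_mul_cancel (by exact_mod_cast hN0) (ENNReal.natCast_ne_top N), one_smul]
    rw [he]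
    have : essSup (ℓ x) (Measure.dirac a) = ℓ x a := by
      have h : ℓ x =ᵐ[Measure.dirac a] fun _ => ℓ x a := by
        rw [ae_dirac_eq]; exact rfl
      rw [essSup_congr_ae h, essSup_const _ (IsProbabilityMeasure.ne_zero _)]
    rw [this]
    exact hcost
end
end

section
/- Suppose Σ ⊂ ℝ^d is compact, ℓ(x,ξ) is upper semicontinuous in ξ with 0 ≤ ℓ(x,ξ) ≤ ℓ^∞(x) = sup_{ξ∈Σ} ℓ(x,ξ) for every x ∈ X, and r > 0. Then for all x ∈ X and all ε > 0, ĉ^ε_{f,LP,r}(x,P_N) = c~^ε_{f,LP,r}(x,P_N) for every empirical (finitely supported) distribution P_N; that is, the LP-smoothed f-divergence DRO predictor and the LP-smoothed empirical f-divergence DRO predictor coincide on empirical distributions. -/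
open MeasureTheory Set Filter Metric Topology
open scoped ENNReal NNReal

set_option linter.unusedSectionVars false

noncomputable section

namespace Dro

variable {Ω : Type*} [MeasurableSpace Ω] [NormedAddCommGroup Ω] [BorelSpace Ω]
variable {X : Type*}

/-- `f^∞ = lim_{u→∞} f(u)/u`. -/
def fInfty (f : ℝ → ℝ) : EReal :=
  Filter.limsup (fun u : ℝ => ((f u / u : ℝ) : EReal)) Filter.atTop

open Classical in
/-- The `f`-divergence `D_f(μ, ν) = ∫ f(dν_c/dμ) dμ + f^∞ ν_s(Σ)`, where `ν = ν_c + ν_s`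
is the Lebesgue decomposition of `ν` with respect to `μ`. -/
def fDiv (f : ℝ → ℝ) (μ ν : Measure Ω) : EReal :=
  if Integrable (fun ξ => f ((ν.rnDeriv μ ξ).toReal)) μ
  then ((∫ ξ, f ((ν.rnDeriv μ ξ).toReal) ∂μ : ℝ) : EReal)
      + fInfty f * (((ν.singularPart μ) Set.univ : ℝ≥0∞) : EReal)
  else ⊤

/-- Wasserstein-smoothed `f`-divergence `D^ε_{f,W}(P', P)`. -/
def fSmoothW (f : ℝ → ℝ) (S : Set Ω) (ε : ℝ) (P' P : ProbabilityMeasure Ω) : EReal :=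
  ⨅ (Q : ProbabilityMeasure Ω) (_ : Q ∈ PMOn S ∧
      wdist (P' : Measure Ω) (Q : Measure Ω) ≤ ENNReal.ofReal ε),
    fDiv f (Q : Measure Ω) (P : Measure Ω)

/-- LP-smoothed `f`-divergence `D^ε_{f,LP}(P', P)`. -/
def fSmoothLP (f : ℝ → ℝ) (S : Set Ω) (ε : ℝ) (P' P : ProbabilityMeasure Ω) : EReal :=
  ⨅ (Q : ProbabilityMeasure Ω) (_ : Q ∈ PMOn S ∧
      lpDist (P' : Measure Ω) (Q : Measure Ω) ≤ ε),
    fDiv f (Q : Measure Ω) (P : Measure Ω)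

/-- The `f`-divergence DRO predictor `ĉ_{f,r}`. -/
def cF (f : ℝ → ℝ) (S : Set Ω) (ℓ : X → Ω → ℝ) (r : ℝ) (x : X)
    (Phat : ProbabilityMeasure Ω) : ℝ :=
  sSup {v | ∃ P ∈ PMOn S,
    fDiv f (Phat : Measure Ω) (P : Measure Ω) ≤ (r : EReal) ∧ v = cost ℓ x P}

/-- The Wasserstein-smoothed `f`-divergence DRO predictor `ĉ^ε_{f,W,r}`. -/
def cFW (f : ℝ → ℝ) (S : Set Ω) (ℓ : X → Ω → ℝ) (ε r : ℝ) (x : X)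
    (Phat : ProbabilityMeasure Ω) : ℝ :=
  sSup {v | ∃ P ∈ PMOn S, fSmoothW f S ε Phat P ≤ (r : EReal) ∧ v = cost ℓ x P}

/-- The LP-smoothed `f`-divergence DRO predictor `ĉ^ε_{f,LP,r}`. -/
def cFLP (f : ℝ → ℝ) (S : Set Ω) (ℓ : X → Ω → ℝ) (ε r : ℝ) (x : X)
    (Phat : ProbabilityMeasure Ω) : ℝ :=
  sSup {v | ∃ P ∈ PMOn S, fSmoothLP f S ε Phat P ≤ (r : EReal) ∧ v = cost ℓ x P}

end Dro
namespace Dro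

variable {Ω : Type*} [MeasurableSpace Ω] [NormedAddCommGroup Ω] [BorelSpace Ω]
variable {X : Type*}

/-- The empirical `f`-divergence DRO predictor `c~_{f,r}`, whose ambiguity set only contains
distributions absolutely continuous with respect to the center `P̂`. -/
def cFemp (f : ℝ → ℝ) (S : Set Ω) (ℓ : X → Ω → ℝ) (r : ℝ) (x : X)
    (Phat : ProbabilityMeasure Ω) : ℝ :=
  sSup {v | ∃ P ∈ PMOn S, (P : Measure Ω) ≪ (Phat : Measure Ω) ∧
    fDiv f (Phat : Measure Ω) (P : Measure Ω) ≤ (r : EReal) ∧ v = cost ℓ x P}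

/-- The LP-smoothed empirical `f`-divergence DRO predictor `c~^ε_{f,LP,r}`. -/
def cFempLP (f : ℝ → ℝ) (S : Set Ω) (ℓ : X → Ω → ℝ) (ε r : ℝ) (x : X)
    (Phat : ProbabilityMeasure Ω) : ℝ :=
  sSup {v | ∃ Q ∈ PMOn S, lpDist (Phat : Measure Ω) (Q : Measure Ω) ≤ ε ∧
    v = cFemp f S ℓ r x Q}

end Dro

namespace DroAux

lemma conv_ineq {f : ℝ → ℝ} (hconv : ConvexOn ℝ (Set.Ici 0) f) {x y a b : ℝ} (hx : 0 ≤ x)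
    (hy : 0 ≤ y) (ha : 0 ≤ a) (hb : 0 ≤ b) (hab : a + b = 1) :
    f (a * x + b * y) ≤ a * f x + b * f y := by
  obtain ⟨-, h⟩ := hconv
  exact h hx hy ha hb hab

lemma f_lower {f : ℝ → ℝ} (hconv : ConvexOn ℝ (Set.Ici 0) f) (hf1 : f 1 = 0) (u : ℝ)
    (hu : 0 ≤ u) : -(u + 1) * (|f 0| + |f 2|) ≤ f u := by
  have a0 := abs_nonneg (f 0)
  have a2 := abs_nonneg (f 2)
  have b0 := le_abs_self (f 0)
  have b2 := le_abs_self (f 2)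
  rcases le_or_gt 1 u with h | h
  · have hu0 : 0 < u := by linarith
    have := conv_ineq hconv (x := 0) (y := u) le_rfl hu (a := 1 - 1/u) (b := 1/u)
      (by rw [sub_nonneg, div_le_one hu0]; exact h) (by positivity) (by ring)
    simp only [mul_zero, zero_add, one_div] at this
    rw [inv_mul_cancel₀ hu0.ne', hf1] at this
    have h2 : 0 ≤ (u - 1) * f 0 + f u := by
      have := mul_le_mul_of_nonneg_left this hu0.le
      field_simp at this
      linarith
    nlinarith
  · have h2 : 0 < 2 - u := by linarith
    have := conv_ineq hconv (x := u) (y := 2) hu (by simp) (a := 1/(2-u))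
      (b := (1-u)/(2-u)) (by positivity) (div_nonneg (by linarith) h2.le) (by field_simp; ring)
    have e : 1 / (2 - u) * u + (1 - u) / (2 - u) * 2 = 1 := by field_simp; ring
    rw [e, hf1] at this
    have h3 : 0 ≤ f u + (1 - u) * f 2 := by
      have := mul_le_mul_of_nonneg_left this h2.le
      field_simp at this
      linarith
    nlinarith

lemma f_growth {f : ℝ → ℝ} (hconv : ConvexOn ℝ (Set.Ici 0) f) {F : ℝ}
    (hF : Dro.fInfty f < (F : EReal)) {x y : ℝ} (hx : 0 ≤ x) (hy : 0 ≤ y) :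
    f (x + y) ≤ f x + y * F := by
  rcases hy.eq_or_lt with rfl | hy
  · simp
  have hev : ∀ᶠ v : ℝ in atTop, ((f v / v : ℝ) : EReal) < F := eventually_lt_of_limsup_lt hF
  have hslope : ∀ᶠ v : ℝ in atTop, (f (x + y) - f x) / y ≤ (F * v - f x) / (v - x) := by
    filter_upwards [hev, eventually_gt_atTop (x + y)] with v hv hvx
    have hv' : f v / v < F := by exact_mod_cast hv
    have hv0 : 0 < v := by linarith
    rw [div_lt_iff₀ hv0] at hv'
    have := hconv.secant_mono (a := x) (x := x + y) (y := v) hx (by simp; linarith)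
      (by simp; linarith) (by linarith) (by linarith) hvx.le
    rw [add_sub_cancel_left] at this
    refine this.trans ?_
    have : 0 < v - x := by linarith
    gcongr
  have hlim : Tendsto (fun v : ℝ => (F * v - f x) / (v - x)) atTop (𝓝 F) := by
    have h1 : Tendsto (fun v : ℝ => F + (F * x - f x) / (v - x)) atTop (𝓝 (F + 0)) := by
      refine tendsto_const_nhds.add ?_
      refine Tendsto.div_atTop tendsto_const_nhds ?_
      simpa [sub_eq_add_neg] using tendsto_atTop_add_const_right atTop (-x) tendsto_id
    rw [add_zero] at h1
    refine h1.congr' ?_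
    filter_upwards [eventually_gt_atTop x] with v hv
    have : v - x ≠ 0 := by linarith
    field_simp
    ring
  have := ge_of_tendsto hlim hslope
  rw [div_le_iff₀ hy] at this
  linarith

lemma f_meas {f : ℝ → ℝ} (hconv : ConvexOn ℝ (Set.Ici 0) f) :
    Measurable (fun u : ℝ≥0∞ => f u.toReal) := by
  classical
  have hc : ContinuousOn f (Set.Ioi 0) := by
    simpa using hconv.continuousOn_interior
  have h1 : Measurable ((Set.Ioi (0:ℝ)).piecewise f (fun _ => f 0)) :=
    hc.measurable_piecewise continuousOn_const measurableSet_Ioi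
  have h2 : (fun u : ℝ≥0∞ => f u.toReal)
      = fun u : ℝ≥0∞ => (Set.Ioi (0:ℝ)).piecewise f (fun _ => f 0) u.toReal := by
    ext u
    by_cases h : u.toReal ∈ Set.Ioi (0:ℝ)
    · simp [Set.piecewise, h]
    · have : u.toReal = 0 := le_antisymm (not_lt.mp h) ENNReal.toReal_nonneg
      simp [Set.piecewise, this]
  rw [h2]
  exact h1.comp ENNReal.measurable_toReal

variable {Ω : Type*} [MeasurableSpace Ω] [NormedAddCommGroup Ω] [BorelSpace Ω]

/-- Extract a finite slope from a finite divergence. -/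
lemma fDiv_extract {f : ℝ → ℝ} (hconv : ConvexOn ℝ (Set.Ici 0) f)
    (Q P : Measure Ω) [IsProbabilityMeasure Q] [IsProbabilityMeasure P] {R : ℝ}
    (h : Dro.fDiv f Q P < (R : EReal)) :
    Integrable (fun ξ => f ((P.rnDeriv Q ξ).toReal)) Q ∧
    ∃ F : ℝ, (∀ x y : ℝ, 0 ≤ x → 0 ≤ y →
        f (x + ((P.singularPart Q) univ).toReal * y)
          ≤ f x + ((P.singularPart Q) univ).toReal * y * F) ∧
      ∫ ξ, f ((P.rnDeriv Q ξ).toReal) ∂Q + ((P.singularPart Q) univ).toReal * F < R := by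
  rw [Dro.fDiv] at h
  split_ifs at h with hi
  swap
  · exact absurd h (by simp)
  refine ⟨hi, ?_⟩
  set p := (P.singularPart Q) univ with hp
  have hpt : p ≠ ⊤ := measure_ne_top _ _
  have hpe : (p : EReal) = ((p.toReal : ℝ) : EReal) := by
    exact (EReal.coe_ennreal_toReal hpt).symm
  rcases (ENNReal.toReal_nonneg : 0 ≤ p.toReal).eq_or_lt with h0 | h0
  · refine ⟨0, fun x y hx hy => by simp [← h0], ?_⟩
    rw [hpe, ← h0] at h
    simp only [EReal.coe_zero, mul_zero, add_zero] at h
    rw [mul_zero, add_zero]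
    exact_mod_cast h
  · rw [hpe] at h
    have hnt : Dro.fInfty f ≠ ⊤ := by
      intro e
      rw [e, EReal.top_mul_coe_of_pos h0] at h
      simp at h
    have hnb : Dro.fInfty f ≠ ⊥ := by
      intro e
      have := f_growth hconv (F := f (1+1) - f 1 - 1) (by rw [e]; exact EReal.bot_lt_coe _)
        (x := 1) (y := 1) (by simp) (by simp)
      linarith
    lift Dro.fInfty f to ℝ using ⟨hnt, hnb⟩ with F hF
    refine ⟨F, fun x y hx hy => ?_, ?_⟩
    · have hy' : 0 ≤ p.toReal * y := by positivity
      refine le_of_forall_pos_le_add fun δ hδ => ?_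
      have := f_growth hconv (F := F + δ / (p.toReal * y + 1))
        (by rw [← hF]; exact_mod_cast lt_add_of_pos_right F (by positivity)) hx hy'
      refine this.trans ?_
      have : p.toReal * y * (δ / (p.toReal * y + 1)) ≤ δ := by
        rw [← mul_div_assoc, div_le_iff₀ (by positivity)]
        nlinarith
      linarith
    · rw [mul_comm]
      exact_mod_cast h

end DroAux
namespace DroAux

variable {Ω : Type*} [MeasurableSpace Ω] [NormedAddCommGroup Ω] [BorelSpace Ω]

/-- The divergence bound for the mixed pair. -/
lemma fDiv_mix {f : ℝ → ℝ} (hconv : ConvexOn ℝ (Set.Ici 0) f) (hf1 : f 1 = 0)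
    (Q K D : Measure Ω) [IsProbabilityMeasure Q] [IsProbabilityMeasure K]
    [IsProbabilityMeasure D] (hDK : D ≪ K) (u : Ω → ℝ≥0∞) (hu : Measurable u)
    (huf : ∫⁻ ξ, u ξ ∂Q ≠ ⊤)
    (p : ℝ≥0∞) (hp : p ≠ ⊤) (t : ℝ) (ht0 : 0 < t) (ht1 : t < 1) (F : ℝ)
    (hF : ∀ x y : ℝ, 0 ≤ x → 0 ≤ y → f (x + p.toReal * y) ≤ f x + p.toReal * y * F)
    (hi : Integrable (fun ξ => f (u ξ).toReal) Q) :
    let L := ENNReal.ofReal (1 - t) • Q + ENNReal.ofReal t • K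
    let P' := ENNReal.ofReal (1 - t) • (Q.withDensity u + p • D) + ENNReal.ofReal t • K
    P' ≪ L ∧ Dro.fDiv f L P' ≤ (((1 - t) * (∫ ξ, f (u ξ).toReal ∂Q + p.toReal * F) : ℝ) : EReal) := by
  intro L P'
  set s : ℝ≥0∞ := ENNReal.ofReal (1 - t) with hs
  set τ : ℝ≥0∞ := ENNReal.ofReal t with hτ
  have hs0 : s ≠ 0 := by simp [hs, ht1]
  have hτ0 : τ ≠ 0 := by simp [hτ, ht0]
  have hst : s ≠ ⊤ := ENNReal.ofReal_ne_top
  have hτt : τ ≠ ⊤ := ENNReal.ofReal_ne_top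
  have hsr : s.toReal = 1 - t := ENNReal.toReal_ofReal (by linarith)
  have hτr : τ.toReal = t := ENNReal.toReal_ofReal ht0.le
  have hfs : IsFiniteMeasure (s • Q) := Measure.smul_finite Q hst
  have hft : IsFiniteMeasure (τ • K) := Measure.smul_finite K hτt
  have : IsFiniteMeasure L := by dsimp only [L]; infer_instance
  have hQL : Q ≪ L := by
    intro A hA
    simp only [L, Measure.add_apply, Measure.smul_apply, smul_eq_mul, add_eq_zero,
      mul_eq_zero] at hA
    exact hA.1.resolve_left hs0
  have hKL : K ≪ L := by
    intro A hA
    simp only [L, Measure.add_apply, Measure.smul_apply, smul_eq_mul, add_eq_zero,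
      mul_eq_zero] at hA
    exact hA.2.resolve_left hτ0
  have hDL : D ≪ L := hDK.trans hKL
  set a := Q.rnDeriv L with ha
  set b := K.rnDeriv L with hb
  set d := D.rnDeriv L with hd
  have ham : Measurable a := Measure.measurable_rnDeriv _ _
  have hbm : Measurable b := Measure.measurable_rnDeriv _ _
  have hdm : Measurable d := Measure.measurable_rnDeriv _ _
  have hQa : L.withDensity a = Q := Measure.withDensity_rnDeriv_eq _ _ hQL
  have hKb : L.withDensity b = K := Measure.withDensity_rnDeriv_eq _ _ hKL
  have hDd : L.withDensity d = D := Measure.withDensity_rnDeriv_eq _ _ hDL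
  set g : Ω → ℝ≥0∞ := s • (a * u + p • d) + τ • b with hg
  have hgm : Measurable g := by
    exact (((ham.mul hu).add (hdm.const_smul p)).const_smul s).add (hbm.const_smul τ)
  have hP' : L.withDensity g = P' := by
    rw [hg, withDensity_add_left (((ham.mul hu).add (hdm.const_smul p)).const_smul s),
      withDensity_smul _ ((ham.mul hu).add (hdm.const_smul p)),
      withDensity_add_left (ham.mul hu), withDensity_smul _ hdm, withDensity_smul _ hbm,
      withDensity_mul _ ham hu, hQa, hKb, hDd]
  have hone : L.withDensity (s • a + τ • b) = L := by
    rw [withDensity_add_left (ham.const_smul s), withDensity_smul _ ham, withDensity_smul _ hbm,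
      hQa, hKb]
  have hac : P' ≪ L := by rw [← hP']; exact withDensity_absolutelyContinuous _ _
  refine ⟨hac, ?_⟩
  have e1 : (s • a + τ • b) =ᵐ[L] fun _ => 1 := by
    have h1 := Measure.rnDeriv_withDensity L ((ham.const_smul s).add (hbm.const_smul τ))
    rw [hone] at h1
    exact h1.symm.trans (Measure.rnDeriv_self L)
  have e2 : P'.rnDeriv L =ᵐ[L] g := by
    rw [← hP']; exact Measure.rnDeriv_withDensity L hgm
  have hal : ∀ᵐ ξ ∂L, a ξ < ⊤ := Measure.rnDeriv_lt_top _ _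
  have hbl : ∀ᵐ ξ ∂L, b ξ < ⊤ := Measure.rnDeriv_lt_top _ _
  have hdl : ∀ᵐ ξ ∂L, d ξ < ⊤ := Measure.rnDeriv_lt_top _ _
  have hauI : ∫⁻ ξ, (a * u) ξ ∂L ≠ ⊤ := by
    rw [← lintegral_withDensity_eq_lintegral_mul _ ham hu, hQa]; exact huf
  have haul : ∀ᵐ ξ ∂L, (a * u) ξ < ⊤ := ae_lt_top (ham.mul hu) hauI
  -- pointwise bounds
  set H : Ω → ℝ := fun ξ => (1 - t) * ((a ξ).toReal * f (u ξ).toReal)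
      + (1 - t) * (p.toReal * F) * (d ξ).toReal with hH
  have hdI : Integrable (fun ξ => (d ξ).toReal) L := Measure.integrable_toReal_rnDeriv
  have hbI : Integrable (fun ξ => (b ξ).toReal) L := Measure.integrable_toReal_rnDeriv
  have haI : Integrable (fun ξ => (a ξ).toReal * f (u ξ).toReal) L :=
    (integrable_rnDeriv_smul_iff hQL (f := fun ξ => f (u ξ).toReal)).2 hi
  have hHI : Integrable H L := (haI.const_mul _).add (hdI.const_mul _)
  have hgv : ∀ᵐ ξ ∂L, (g ξ).toReal =
      (1 - t) * ((a * u) ξ).toReal + (1 - t) * p.toReal * (d ξ).toReal + t * (b ξ).toReal := by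
    filter_upwards [haul, hbl, hdl] with ξ h1 h2 h3
    simp only [hg, Pi.add_apply, Pi.smul_apply, smul_eq_mul]
    have h3' : p * d ξ ≠ ⊤ := ENNReal.mul_ne_top hp h3.ne
    rw [ENNReal.toReal_add (ENNReal.mul_ne_top hst (ENNReal.add_ne_top.2 ⟨h1.ne, h3'⟩))
      (ENNReal.mul_ne_top hτt h2.ne), ENNReal.toReal_mul, ENNReal.toReal_add h1.ne h3',
      ENNReal.toReal_mul (a := τ), ENNReal.toReal_mul (a := p), hsr, hτr]
    ring
  have hup : ∀ᵐ ξ ∂L, f (g ξ).toReal ≤ H ξ := by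
    filter_upwards [hgv, e1, hal, hbl] with ξ h1 h2 h3 h4
    have h5 : (1 - t) * (a ξ).toReal + t * (b ξ).toReal = 1 := by
      simp only [Pi.add_apply, Pi.smul_apply, smul_eq_mul] at h2
      have := congrArg ENNReal.toReal h2
      rw [ENNReal.toReal_add (ENNReal.mul_ne_top hst h3.ne) (ENNReal.mul_ne_top hτt h4.ne),
        ENNReal.toReal_mul, ENNReal.toReal_mul, hsr, hτr] at this
      simpa using this
    have ht' : 0 ≤ 1 - t := by linarith
    have c1 := conv_ineq hconv (x := (u ξ).toReal) (y := 1) ENNReal.toReal_nonneg zero_le_one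
      (mul_nonneg ht' ENNReal.toReal_nonneg) (mul_nonneg ht0.le ENNReal.toReal_nonneg) h5
    have c2 := hF ((1 - t) * (a ξ).toReal * (u ξ).toReal + t * (b ξ).toReal * 1)
      ((1 - t) * (d ξ).toReal) (by positivity) (by positivity)
    rw [hf1] at c1
    have e : (g ξ).toReal = (1 - t) * (a ξ).toReal * (u ξ).toReal + t * (b ξ).toReal * 1 +
        p.toReal * ((1 - t) * (d ξ).toReal) := by
      rw [h1, Pi.mul_apply, ENNReal.toReal_mul]; ring
    rw [e, hH]
    refine c2.trans ?_
    simp only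
    linarith
  have hgI : Integrable (fun ξ => (g ξ).toReal) L := by
    refine (((integrable_toReal_of_lintegral_ne_top (ham.mul hu).aemeasurable hauI).const_mul
      (1 - t)).add (hdI.const_mul ((1 - t) * p.toReal))).add (hbI.const_mul t) |>.congr ?_
    filter_upwards [hgv] with ξ h
    simp only [Pi.add_apply]
    rw [h]
  have hfgI : Integrable (fun ξ => f (g ξ).toReal) L := by
    refine integrable_of_le_of_le (((f_meas hconv).comp hgm).aestronglyMeasurable)
      (g₁ := fun ξ => -((g ξ).toReal + 1) * (|f 0| + |f 2|)) (g₂ := H) ?_ hup ?_ hHI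
    · exact Eventually.of_forall fun ξ => f_lower hconv hf1 _ ENNReal.toReal_nonneg
    · exact ((hgI.add (integrable_const 1)).neg).mul_const _
  have hcongr : (fun ξ => f (P'.rnDeriv L ξ).toReal) =ᵐ[L] fun ξ => f (g ξ).toReal := by
    filter_upwards [e2] with ξ h
    rw [h]
  rw [Dro.fDiv, if_pos (hfgI.congr hcongr.symm), Measure.singularPart_eq_zero_of_ac hac,
    integral_congr_ae hcongr]
  simp only [Measure.coe_zero, Pi.zero_apply, EReal.coe_ennreal_zero, mul_zero, add_zero]
  rw [EReal.coe_le_coe_iff]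
  refine (integral_mono_ae hfgI hHI hup).trans (le_of_eq ?_)
  rw [hH, integral_add (haI.const_mul _) (hdI.const_mul _), integral_const_mul,
    integral_const_mul]
  have i1 : ∫ ξ, (a ξ).toReal * f (u ξ).toReal ∂L = ∫ ξ, f (u ξ).toReal ∂Q :=
    integral_rnDeriv_smul hQL (f := fun ξ => f (u ξ).toReal)
  have i2 : ∫ ξ, (d ξ).toReal ∂L = 1 := by
    rw [hd, Measure.integral_toReal_rnDeriv hDL]
    simp
  rw [i1, i2]
  ring

/-- Mixing stays in the Lévy–Prokhorov ball. -/
lemma lpDist_mix (E Q D : Measure Ω) [IsProbabilityMeasure E] [IsProbabilityMeasure Q]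
    [IsProbabilityMeasure D] (ε η t : ℝ) (hη0 : 0 < η) (hη1 : η ≤ 1) (hηε : η ≤ ε)
    (ht0 : 0 < t) (ht1 : t < 1) (h : Dro.lpDist E Q ≤ ε) :
    Dro.lpDist E (ENNReal.ofReal (1 - t) • Q + ENNReal.ofReal t •
      (ENNReal.ofReal (1 - η) • E + ENNReal.ofReal η • D)) ≤ ε := by
  refine le_of_forall_pos_le_add fun γ hγ => ?_
  have hne : {ε : ℝ | 0 < ε ∧ ∀ A : Set Ω, MeasurableSet A →
      (E A ≤ Q (Metric.cthickening ε A) + ENNReal.ofReal ε ∧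
       Q A ≤ E (Metric.cthickening ε A) + ENNReal.ofReal ε)}.Nonempty := by
    refine ⟨1, one_pos, fun A _ => ⟨?_, ?_⟩⟩
    · exact prob_le_one.trans (by simp)
    · exact prob_le_one.trans (by simp)
  obtain ⟨e, ⟨he0, he⟩, hle⟩ := exists_lt_of_csInf_lt hne
    (show Dro.lpDist E Q < ε + γ by linarith)
  refine csInf_le ⟨0, fun y hy => hy.1.le⟩ ⟨by linarith, fun A hA => ?_⟩
  have hsub : cthickening e A ⊆ cthickening (ε + γ) A := cthickening_mono hle.le A
  have hself : A ⊆ cthickening (ε + γ) A := self_subset_cthickening A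
  obtain ⟨h1, h2⟩ := he A hA
  have h1' : E A ≤ Q (cthickening (ε + γ) A) + ENNReal.ofReal (ε + γ) :=
    h1.trans (add_le_add (measure_mono hsub) (ENNReal.ofReal_le_ofReal hle.le))
  have h2' : Q A ≤ E (cthickening (ε + γ) A) + ENNReal.ofReal (ε + γ) :=
    h2.trans (add_le_add (measure_mono hsub) (ENNReal.ofReal_le_ofReal hle.le))
  have h3 : E A ≤ E (cthickening (ε + γ) A) := measure_mono hself
  have hD : D A ≤ 1 := prob_le_one
  have hE1 : E A ≤ 1 := prob_le_one
  simp only [Measure.add_apply, Measure.smul_apply, smul_eq_mul]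
  set B := cthickening (ε + γ) A
  have ef : ∀ (μ : Measure Ω) [IsProbabilityMeasure μ] (C : Set Ω),
      ∃ v : ℝ, 0 ≤ v ∧ μ C = ENNReal.ofReal v := fun μ _ C =>
    ⟨(μ C).toReal, ENNReal.toReal_nonneg, (ENNReal.ofReal_toReal (measure_ne_top _ _)).symm⟩
  obtain ⟨ea, hea, Hea⟩ := ef E A
  obtain ⟨eb, heb, Heb⟩ := ef E B
  obtain ⟨qa, hqa, Hqa⟩ := ef Q A
  obtain ⟨qb, hqb, Hqb⟩ := ef Q B
  obtain ⟨da, hda, Hda⟩ := ef D A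
  obtain ⟨db, hdb, Hdb⟩ := ef D B
  rw [Hea, Heb] at h3
  rw [Hea, Hqb] at h1'
  rw [Hqa, Heb] at h2'
  rw [Hda] at hD
  rw [Hea] at hE1
  rw [Hea, Heb, Hqa, Hqb, Hda, Hdb]
  have p1 : 0 ≤ 1 - t := by linarith
  have p2 : 0 ≤ 1 - η := by linarith
  have p3 : 0 ≤ ε + γ := by linarith
  have p4 := ht0.le
  have p5 := hη0.le
  rw [← ENNReal.ofReal_add hqb p3, ENNReal.ofReal_le_ofReal_iff (by positivity)] at h1'
  rw [← ENNReal.ofReal_add heb p3, ENNReal.ofReal_le_ofReal_iff (by positivity)] at h2'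
  rw [ENNReal.ofReal_le_ofReal_iff heb] at h3
  rw [ENNReal.ofReal_le_one] at hD hE1
  simp (discharger := positivity) only [← ENNReal.ofReal_mul, ← ENNReal.ofReal_add]
  constructor
  · rw [ENNReal.ofReal_le_ofReal_iff (by positivity)]
    have k1 := mul_le_mul_of_nonneg_left h1' p1
    have k2 : (1 - η) * ea ≤ (1 - η) * eb := mul_le_mul_of_nonneg_left h3 p2
    have k3 : η * ea ≤ η * 1 := mul_le_mul_of_nonneg_left hE1 p5
    have k5 : 0 ≤ η * db := by positivity
    have k4 := mul_le_mul_of_nonneg_left (show ea ≤ (1 - η) * eb + η * db + (ε + γ) by linarith) p4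
    linarith
  · rw [ENNReal.ofReal_le_ofReal_iff (by positivity)]
    have k1 := mul_le_mul_of_nonneg_left h2' p1
    have k2 : (1 - η) * ea ≤ (1 - η) * eb := mul_le_mul_of_nonneg_left h3 p2
    have k3 : η * da ≤ η * 1 := mul_le_mul_of_nonneg_left hD p5
    have k6 : 0 ≤ η * eb := by positivity
    have k4 := mul_le_mul_of_nonneg_left (show (1 - η) * ea + η * da ≤ eb + (ε + γ) by linarith) p4
    linarith

end DroAux
namespace DroAux

variable {Ω : Type*} [MeasurableSpace Ω] [NormedAddCommGroup Ω] [BorelSpace Ω]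
variable {X : Type*}

lemma ae_mem {S : Set Ω} {μ : Measure Ω} (h : μ Sᶜ = 0) : ∀ᵐ ξ ∂μ, ξ ∈ S := h

lemma loss_integrable {S : Set Ω} (hS : MeasurableSet S) {g : Ω → ℝ}
    (hg : UpperSemicontinuousOn g S) (h0 : ∀ ξ ∈ S, 0 ≤ g ξ) {M : ℝ} (hM : ∀ ξ ∈ S, g ξ ≤ M)
    (μ : Measure Ω) [IsFiniteMeasure μ] (hμ : μ Sᶜ = 0) : Integrable g μ := by
  have hm : AEMeasurable g μ := by
    rw [← Measure.restrict_eq_self_of_ae_mem (ae_mem hμ), aemeasurable_restrict_iff_comap_subtype hS]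
    exact (upperSemicontinuousOn_iff_restrict.2 hg).measurable.aemeasurable
  refine Integrable.of_bound hm.aestronglyMeasurable M ?_
  filter_upwards [ae_mem hμ] with ξ hξ
  rw [Real.norm_of_nonneg (h0 ξ hξ)]
  exact hM ξ hξ

lemma compl_zero {S : Set Ω} (hS : MeasurableSet S) {P : ProbabilityMeasure Ω}
    (hP : P ∈ Dro.PMOn S) : (P : Measure Ω) Sᶜ = 0 := by
  have h : (P : Measure Ω) S = 1 := hP
  exact (prob_compl_eq_zero_iff hS).2 h

lemma mem_of_compl_zero {S : Set Ω} (hS : MeasurableSet S) {P : ProbabilityMeasure Ω}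
    (hP : (P : Measure Ω) Sᶜ = 0) : P ∈ Dro.PMOn S := (prob_compl_eq_zero_iff hS).1 hP

lemma cost_le {S : Set Ω} (hS : MeasurableSet S) {ℓ : X → Ω → ℝ} {x : X}
    (hg : UpperSemicontinuousOn (ℓ x) S) (h0 : ∀ ξ ∈ S, 0 ≤ ℓ x ξ) {M : ℝ}
    (hM : ∀ ξ ∈ S, ℓ x ξ ≤ M) {P : ProbabilityMeasure Ω} (hP : P ∈ Dro.PMOn S) :
    Dro.cost ℓ x P ≤ M := by
  have hc := compl_zero hS hP
  have hi := loss_integrable hS hg h0 hM (P : Measure Ω) hc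
  have := integral_mono_ae hi (integrable_const M)
    (by filter_upwards [ae_mem hc] with ξ hξ using hM ξ hξ)
  simpa [Dro.cost] using this

lemma fDiv_self {f : ℝ → ℝ} (hf1 : f 1 = 0) (Q : Measure Ω) [IsProbabilityMeasure Q] :
    Dro.fDiv f Q Q = 0 := by
  have h : (fun ξ => f (Q.rnDeriv Q ξ).toReal) =ᵐ[Q] fun _ => 0 := by
    filter_upwards [Measure.rnDeriv_self Q] with ξ hξ
    simp [hξ, hf1]
  rw [Dro.fDiv, if_pos ((integrable_zero _ _ _).congr h.symm), integral_congr_ae h]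
  simp [Measure.singularPart_self]

lemma lpDist_self (E : Measure Ω) : ∀ ε > 0, Dro.lpDist E E ≤ ε := by
  intro ε hε
  refine csInf_le ⟨0, fun y hy => hy.1.le⟩ ⟨hε, fun A _ => ?_⟩
  have : E A ≤ E (cthickening ε A) := measure_mono (self_subset_cthickening A)
  exact ⟨this.trans le_self_add, this.trans le_self_add⟩

lemma cFemp_set_bdd {S : Set Ω} (hS : MeasurableSet S) {ℓ : X → Ω → ℝ} {x : X}
    (hg : UpperSemicontinuousOn (ℓ x) S) (h0 : ∀ ξ ∈ S, 0 ≤ ℓ x ξ) {M : ℝ}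
    (hM : ∀ ξ ∈ S, ℓ x ξ ≤ M) (f : ℝ → ℝ) (r : ℝ) (Q : ProbabilityMeasure Ω) :
    BddAbove {v | ∃ P ∈ Dro.PMOn S, (P : Measure Ω) ≪ (Q : Measure Ω) ∧
    Dro.fDiv f (Q : Measure Ω) (P : Measure Ω) ≤ (r : EReal) ∧ v = Dro.cost ℓ x P} := by
  refine ⟨M, ?_⟩
  rintro v ⟨P, hP, -, -, rfl⟩
  exact cost_le hS hg h0 hM hP

lemma cFemp_le {S : Set Ω} (hS : MeasurableSet S) {ℓ : X → Ω → ℝ} {x : X}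
    (hg : UpperSemicontinuousOn (ℓ x) S) (h0 : ∀ ξ ∈ S, 0 ≤ ℓ x ξ) {M : ℝ}
    (hM : ∀ ξ ∈ S, ℓ x ξ ≤ M) {f : ℝ → ℝ} (hf1 : f 1 = 0) {r : ℝ} (hr : 0 < r)
    {Q : ProbabilityMeasure Ω} (hQ : Q ∈ Dro.PMOn S) : Dro.cFemp f S ℓ r x Q ≤ M := by
  refine csSup_le ⟨_, Q, hQ, Measure.AbsolutelyContinuous.rfl, ?_, rfl⟩ ?_
  · rw [fDiv_self hf1]; exact_mod_cast hr.le
  rintro v ⟨P, hP, -, -, rfl⟩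
  exact cost_le hS hg h0 hM hP

lemma core {S : Set Ω} (hS : MeasurableSet S) {f : ℝ → ℝ}
    (hconv : ConvexOn ℝ (Set.Ici 0) f) (hf1 : f 1 = 0) {ℓ : X → Ω → ℝ} {x : X}
    (hg : UpperSemicontinuousOn (ℓ x) S) (h0 : ∀ ξ ∈ S, 0 ≤ ℓ x ξ)
    {z : Ω} (hz : z ∈ S) (hM : ∀ ξ ∈ S, ℓ x ξ ≤ ℓ x z) {r : ℝ} (hr : 0 < r) {ε : ℝ} (hε : 0 < ε)
    {E P : ProbabilityMeasure Ω} (hE : E ∈ Dro.PMOn S) (hP : P ∈ Dro.PMOn S)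
    (h : Dro.fSmoothLP f S ε E P ≤ (r : EReal)) {t : ℝ} (ht0 : 0 < t) (ht1 : t < 1) :
    (1 - t) * Dro.cost ℓ x P ≤ Dro.cFempLP f S ℓ ε r x E := by
  have p1 : 0 < 1 - t := by linarith
  have hR : r < r / (1 - t) := by
    rw [lt_div_iff₀ p1]; nlinarith
  have h' : Dro.fSmoothLP f S ε E P < ((r / (1 - t) : ℝ) : EReal) :=
    h.trans_lt (by exact_mod_cast hR)
  rw [Dro.fSmoothLP] at h'
  simp only [iInf_lt_iff] at h'
  obtain ⟨Q, ⟨hQ, hLP⟩, hfd⟩ := h'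
  obtain ⟨hi, F, hF, hlt⟩ := fDiv_extract hconv _ _ hfd
  set u := (P : Measure Ω).rnDeriv (Q : Measure Ω) with hu
  set ps := (P : Measure Ω).singularPart (Q : Measure Ω) with hps
  set p := ps univ with hp
  have hpt : p ≠ ⊤ := measure_ne_top _ _
  have hdec : ps + (Q : Measure Ω).withDensity u = P := Measure.singularPart_add_rnDeriv _ _
  set η := min ε 1 with hη
  have hη0 : 0 < η := lt_min hε one_pos
  have hη1 : η ≤ 1 := min_le_right _ _
  have hηε : η ≤ ε := min_le_left _ _
  set D : Measure Ω := Measure.dirac z with hD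
  have hDS : D Sᶜ = 0 := by rw [hD, Measure.dirac_apply' _ hS.compl]; simp [hz]
  have hmix : ∀ (s : ℝ), 0 ≤ s → s ≤ 1 → ∀ μ ν : Measure Ω, IsProbabilityMeasure μ →
      IsProbabilityMeasure ν →
      IsProbabilityMeasure (ENNReal.ofReal (1 - s) • μ + ENNReal.ofReal s • ν) := by
    intro s hs0 hs1 μ ν _ _
    constructor
    simp only [Measure.add_apply, Measure.smul_apply, measure_univ, smul_eq_mul, mul_one]
    rw [← ENNReal.ofReal_add (by linarith) hs0]
    simp
  set K : Measure Ω := ENNReal.ofReal (1 - η) • (E : Measure Ω) + ENNReal.ofReal η • D with hK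
  have hKp : IsProbabilityMeasure K := hmix η hη0.le hη1 _ _ inferInstance inferInstance
  have hDK : D ≪ K := by
    intro A hA
    simp only [hK, Measure.add_apply, Measure.smul_apply, smul_eq_mul, add_eq_zero,
      mul_eq_zero] at hA
    exact hA.2.resolve_left (by simp [hη0])
  have hES := compl_zero hS hE
  have hQS := compl_zero hS hQ
  have hPS := compl_zero hS hP
  have hKS : K Sᶜ = 0 := by simp [hK, hES, hDS]
  have hPS' := hPS
  rw [← hdec, Measure.add_apply, add_eq_zero] at hPS'
  obtain ⟨hpsS, hpcS⟩ := hPS'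
  have hpcprob : IsProbabilityMeasure ((Q : Measure Ω).withDensity u + p • D) := by
    constructor
    have : ((ps + (Q : Measure Ω).withDensity u : Measure Ω)) univ = 1 := by rw [hdec]; simp
    rw [Measure.add_apply] at this
    rw [Measure.add_apply, Measure.smul_apply, measure_univ (μ := D), smul_eq_mul, mul_one, add_comm]
    exact this
  have huf : ∫⁻ ξ, u ξ ∂(Q : Measure Ω) ≠ ⊤ := (Measure.lintegral_rnDeriv_lt_top _ _).ne
  obtain ⟨hac, hdiv⟩ := fDiv_mix hconv hf1 (Q : Measure Ω) K D hDK u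
    (Measure.measurable_rnDeriv _ _) huf p hpt t ht0 ht1 F hF hi
  have hlp := lpDist_mix (E : Measure Ω) (Q : Measure Ω) D ε η t hη0 hη1 hηε ht0 ht1 hLP
  rw [← hK] at hlp
  set Q' : ProbabilityMeasure Ω := ⟨_, hmix t ht0.le ht1.le Q K inferInstance hKp⟩ with hQ'
  set P' : ProbabilityMeasure Ω := ⟨_, hmix t ht0.le ht1.le _ K hpcprob hKp⟩ with hP'
  have hQ'S : Q' ∈ Dro.PMOn S := by
    refine mem_of_compl_zero hS ?_
    simp [hQ', hQS, hKS]
  have hP'S : P' ∈ Dro.PMOn S := by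
    refine mem_of_compl_zero hS ?_
    simp [hP', hpcS, hKS, hDS]
  have hdiv' : Dro.fDiv f (Q' : Measure Ω) (P' : Measure Ω) ≤ (r : EReal) := by
    refine hdiv.trans ?_
    rw [EReal.coe_le_coe_iff]
    rw [lt_div_iff₀ p1] at hlt
    linarith
  have hI : ∀ μ : Measure Ω, IsFiniteMeasure μ → μ Sᶜ = 0 → Integrable (ℓ x) μ :=
    fun μ _ hμ => loss_integrable hS hg h0 hM μ hμ
  have hpcf : IsFiniteMeasure ((Q : Measure Ω).withDensity u) :=
    isFiniteMeasure_withDensity huf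
  have hpsf : IsFiniteMeasure ps := by rw [hps]; infer_instance
  have hIps := hI ps hpsf hpsS
  have hIpc := hI _ hpcf hpcS
  have hID := hI D inferInstance hDS
  have hIK := hI K inferInstance hKS
  have hcostP : Dro.cost ℓ x P = ∫ ξ, ℓ x ξ ∂ps + ∫ ξ, ℓ x ξ ∂((Q : Measure Ω).withDensity u) := by
    rw [Dro.cost, ← hdec, integral_add_measure hIps hIpc]
  have hDv : ∫ ξ, ℓ x ξ ∂D = ℓ x z := integral_dirac _ _
  have hcostP' : Dro.cost ℓ x P' = (1 - t) * (∫ ξ, ℓ x ξ ∂((Q : Measure Ω).withDensity u)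
      + p.toReal * ℓ x z) + t * ∫ ξ, ℓ x ξ ∂K := by
    rw [Dro.cost, hP']
    simp only [ProbabilityMeasure.coe_mk]
    rw [integral_add_measure ((hIpc.add_measure (hID.smul_measure hpt)).smul_measure
        ENNReal.ofReal_ne_top) (hIK.smul_measure ENNReal.ofReal_ne_top),
      integral_smul_measure, integral_smul_measure,
      integral_add_measure hIpc (hID.smul_measure hpt), integral_smul_measure, hDv,
      ENNReal.toReal_ofReal p1.le, ENNReal.toReal_ofReal ht0.le]
    simp only [smul_eq_mul]
  have hpsle : ∫ ξ, ℓ x ξ ∂ps ≤ p.toReal * ℓ x z := by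
    have := integral_mono_ae hIps (integrable_const (ℓ x z))
      (by filter_upwards [ae_mem hpsS] with ξ hξ using hM ξ hξ)
    simpa [Measure.real, hp] using this
  have hKnn : 0 ≤ ∫ ξ, ℓ x ξ ∂K :=
    integral_nonneg_of_ae (by filter_upwards [ae_mem hKS] with ξ hξ using h0 ξ hξ)
  have hfin : (1 - t) * Dro.cost ℓ x P ≤ Dro.cost ℓ x P' := by
    rw [hcostP, hcostP']
    have := mul_nonneg ht0.le hKnn
    have := mul_le_mul_of_nonneg_left hpsle p1.le
    linarith
  refine hfin.trans ?_
  have hin : Dro.cost ℓ x P' ≤ Dro.cFemp f S ℓ r x Q' :=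
    le_csSup (cFemp_set_bdd hS hg h0 hM f r Q') ⟨P', hP'S, hac, hdiv', rfl⟩
  refine hin.trans ?_
  refine le_csSup ⟨ℓ x z, ?_⟩ ⟨Q', hQ'S, hlp, rfl⟩
  rintro v ⟨Q₁, hQ₁, -, rfl⟩
  exact cFemp_le hS hg h0 hM hf1 hr hQ₁

lemma empPM_mem {S : Set Ω} (hS : MeasurableSet S) {N : ℕ} (hN : 1 ≤ N) (ω : Fin N → Ω)
    (hω : ∀ i, ω i ∈ S) : Dro.empPM N ω ∈ Dro.PMOn S := by
  refine mem_of_compl_zero hS ?_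
  have hN' : N ≠ 0 := by omega
  have he : ((Dro.empPM N ω : ProbabilityMeasure Ω) : Measure Ω) = Dro.empMeas ω := by
    have h2 : Dro.empPM N ω = ⟨Dro.empMeas ω, Dro.empMeas_isProbability hN' ω⟩ := dif_neg hN'
    rw [h2]
    rfl
  rw [he]
  simp only [Dro.empMeas, Measure.smul_apply, Measure.finsetSum_apply]
  have : ∀ i, Measure.dirac (ω i) Sᶜ = 0 := fun i => by
    rw [Measure.dirac_apply' _ hS.compl]; simp [hω i]
  simp [this]

end DroAux

/-- Theorem: Equivalence between smoothed DRO and smoothed empirical DRO.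
Suppose `Σ ⊂ ℝ^d` is compact, `ℓ(x,·)` is upper semicontinuous and `0 ≤ ℓ(x,ξ) ≤ ℓ^∞(x)` on
`Σ` for every `x`, and `r > 0`.  Then for every `x` and `ε > 0`, the LP-smoothed
`f`-divergence DRO predictor and the LP-smoothed empirical `f`-divergence DRO predictor
coincide at every empirical distribution `P_N`. -/
theorem smoothed_dro_eq_smoothed_empirical_dro
    {n : ℕ} {X : Type*} [Nonempty X]
    (S : Set (Euc n)) (hS : IsCompact S)
    (f : ℝ → ℝ) (hconv : ConvexOn ℝ (Set.Ici 0) f)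
    (hlsc : LowerSemicontinuousOn f (Set.Ici 0)) (hf1 : f 1 = 0)
    (ℓ : X → Euc n → ℝ) (husc : ∀ x, UpperSemicontinuousOn (ℓ x) S)
    (h0 : ∀ x, ∀ ξ ∈ S, 0 ≤ ℓ x ξ)
    (r : ℝ) (hr : 0 < r) (ε : ℝ) (hε : 0 < ε) (x : X) :
    ∀ (N : ℕ), 1 ≤ N → ∀ ω : Fin N → Euc n, (∀ i, ω i ∈ S) →
      Dro.cFLP f S ℓ ε r x (Dro.empPM N ω) = Dro.cFempLP f S ℓ ε r x (Dro.empPM N ω) := by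
  intro N hN ω hω
  have hSm : MeasurableSet S := hS.isClosed.measurableSet
  have hSne : S.Nonempty := ⟨ω ⟨0, hN⟩, hω _⟩
  obtain ⟨z, hz, hmax⟩ := (husc x).exists_isMaxOn hSne hS
  have hM : ∀ ξ ∈ S, ℓ x ξ ≤ ℓ x z := fun ξ hξ => hmax hξ
  have hE := DroAux.empPM_mem hSm hN ω hω
  set E := Dro.empPM N ω with hEdef
  have hself := DroAux.lpDist_self (E : Measure (Euc n)) ε hε
  have hself2 : Dro.fDiv f (E : Measure (Euc n)) E ≤ (r : EReal) := by
    rw [DroAux.fDiv_self hf1]; exact_mod_cast hr.le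
  apply le_antisymm
  · refine csSup_le ⟨_, E, hE, ?_, rfl⟩ ?_
    · exact (iInf₂_le E ⟨hE, hself⟩).trans hself2
    rintro v ⟨P, hP, hPr, rfl⟩
    have hlim : Tendsto (fun t : ℝ => (1 - t) * Dro.cost ℓ x P) (𝓝[>] 0)
        (𝓝 ((1 - 0) * Dro.cost ℓ x P)) :=
      (Continuous.tendsto (by fun_prop) 0).mono_left nhdsWithin_le_nhds
    rw [sub_zero, one_mul] at hlim
    refine le_of_tendsto hlim ?_
    filter_upwards [Ioo_mem_nhdsGT (zero_lt_one (α := ℝ))] with t ht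
    exact DroAux.core hSm hconv hf1 (husc x) (h0 x) hz hM hr hε hE hP hPr ht.1 ht.2
  · refine csSup_le ⟨_, E, hE, hself, rfl⟩ ?_
    rintro v ⟨Q, hQ, hLP, rfl⟩
    refine csSup_le ⟨_, Q, hQ, Measure.AbsolutelyContinuous.rfl, ?_, rfl⟩ ?_
    · rw [DroAux.fDiv_self hf1]; exact_mod_cast hr.le
    rintro v ⟨P, hP, -, hPr, rfl⟩
    refine le_csSup ⟨ℓ x z, ?_⟩ ⟨P, hP, (iInf₂_le Q ⟨hQ, hLP⟩).trans hPr, rfl⟩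
    rintro v ⟨P₁, hP₁, -, rfl⟩
    exact DroAux.cost_le hSm (husc x) (h0 x) hM hP₁
end
end

section
/- Suppose Σ ⊂ ℝ^d is a compact set and ℓ(x,ξ) is upper semicontinuous in ξ for every x ∈ X. Let D : P(Σ) × P(Σ) → [0,∞] be a jointly convex, lower semicontinuous statistical distance. Then for every ε > 0 and r ≥ 0 the DRO predictors ĉ_{D,R^ε_{D,W}(r)} and ĉ_{D,R^ε_{D,LP}(r)} are uniformly feasible at rate r. Moreover, if 0 ≤ η < R_D(r) and r > 0, then there exists a decision-free loss (ℓ(x,ξ) = ℓ₀(ξ) with ℓ₀ : Σ → ℝ continuous) such that ĉ_{D,η} is not pointwise feasible at rate r. -/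
open MeasureTheory Set Filter Metric Topology
open scoped ENNReal NNReal

set_option linter.unusedSectionVars false

noncomputable section

namespace Dro

variable {Ω : Type*} [MeasurableSpace Ω] [NormedAddCommGroup Ω] [BorelSpace Ω]

/-- The convex mixture `t • μ + (1 - t) • ν` of two measures. -/
def mix (t : ℝ) (μ ν : Measure Ω) : Measure Ω :=
  ENNReal.ofReal t • μ + ENNReal.ofReal (1 - t) • ν

theorem mix_isProbability (t : ℝ) (ht : t ∈ Set.Icc (0:ℝ) 1) (μ ν : ProbabilityMeasure Ω) :
    IsProbabilityMeasure (mix t (μ : Measure Ω) (ν : Measure Ω)) := by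
  constructor
  rw [mix, Measure.add_apply, Measure.smul_apply, Measure.smul_apply, measure_univ, measure_univ,
    smul_eq_mul, smul_eq_mul, mul_one, mul_one,
    ← ENNReal.ofReal_add ht.1 (by linarith [ht.2]), show t + (1 - t) = 1 by ring,
    ENNReal.ofReal_one]

/-- The convex mixture of two probability measures. -/
def mixPM (t : ℝ) (ht : t ∈ Set.Icc (0:ℝ) 1) (μ ν : ProbabilityMeasure Ω) :
    ProbabilityMeasure Ω :=
  ⟨mix t (μ : Measure Ω) (ν : Measure Ω), mix_isProbability t ht μ ν⟩

/-- Convexity of a set of probability measures. -/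
def IsConvexPM (A : Set (ProbabilityMeasure Ω)) : Prop :=
  ∀ μ ∈ A, ∀ ν ∈ A, ∀ t, ∀ ht : t ∈ Set.Icc (0:ℝ) 1, mixPM t ht μ ν ∈ A

end Dro
namespace Dro

variable {Ω : Type*} [MeasurableSpace Ω] [NormedAddCommGroup Ω] [BorelSpace Ω]
variable {X : Type*}

/-- DRO predictor `ĉ_{D,η}` associated with a general statistical distance `D` and radius
`η`. -/
def cDist (D : ProbabilityMeasure Ω → ProbabilityMeasure Ω → ℝ≥0∞) (S : Set Ω)
    (ℓ : X → Ω → ℝ) (η : ℝ≥0∞) (x : X) (Phat : ProbabilityMeasure Ω) : ℝ :=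
  sSup {v | ∃ P ∈ PMOn S, D Phat P ≤ η ∧ v = cost ℓ x P}

/-- `R^ε_{D,W}(r)`: the largest `D`-distance over pairs at smoothed-KL (Wasserstein)
distance at most `r`. -/
def RadW (D : ProbabilityMeasure Ω → ProbabilityMeasure Ω → ℝ≥0∞) (S : Set Ω)
    (ε r : ℝ) : ℝ≥0∞ :=
  sSup {w | ∃ Ph ∈ PMOn S, ∃ P ∈ PMOn S,
    klSmoothW S ε Ph P ≤ ENNReal.ofReal r ∧ w = D Ph P}

/-- `R^ε_{D,LP}(r)`: the largest `D`-distance over pairs at smoothed-KL (Lévy–Prokhorov)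
distance at most `r`. -/
def RadLP (D : ProbabilityMeasure Ω → ProbabilityMeasure Ω → ℝ≥0∞) (S : Set Ω)
    (ε r : ℝ) : ℝ≥0∞ :=
  sSup {w | ∃ Ph ∈ PMOn S, ∃ P ∈ PMOn S,
    klSmoothLP S ε Ph P ≤ ENNReal.ofReal r ∧ w = D Ph P}

/-- `R_D(r)`: the largest `D`-distance over pairs at KL divergence at most `r`. -/
def Rad (D : ProbabilityMeasure Ω → ProbabilityMeasure Ω → ℝ≥0∞) (S : Set Ω)
    (r : ℝ) : ℝ≥0∞ :=
  sSup {w | ∃ Ph ∈ PMOn S, ∃ P ∈ PMOn S,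
    klDiv (Ph : Measure Ω) (P : Measure Ω) ≤ ENNReal.ofReal r ∧ w = D Ph P}

end Dro

open MeasureTheory Set Filter Metric Topology
open scoped ENNReal NNReal
namespace DroAux

lemma lintegral_pi_prod {α : Type*} [MeasurableSpace α] {N : ℕ} (P : Measure α)
    [IsProbabilityMeasure P] (f : Fin N → α → ℝ≥0∞) (hf : ∀ i, Measurable (f i)) :
    ∫⁻ ω, ∏ i, f i (ω i) ∂(Measure.pi fun _ : Fin N => P) = ∏ i, ∫⁻ x, f i x ∂P := by
  rw [ProbabilityTheory.lintegral_prod_eq_prod_lintegral_of_indepFun Finset.univ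
    (fun i (ω : Fin N → α) => f i (ω i))
    (ProbabilityTheory.iIndepFun_pi fun i => (hf i).aemeasurable)
    (fun i => (hf i).comp (measurable_pi_apply i))]
  refine Finset.prod_congr rfl fun i _ => ?_
  exact (measurePreserving_eval (fun _ : Fin N => P) i).lintegral_comp (hf i)

lemma pi_withDensity {α : Type*} [MeasurableSpace α] {N : ℕ} (P : Measure α)
    [IsProbabilityMeasure P] (f : α → ℝ≥0∞) (hf : Measurable f)
    [IsProbabilityMeasure (P.withDensity f)] :
    (Measure.pi fun _ : Fin N => P.withDensity f) =
      (Measure.pi fun _ : Fin N => P).withDensity (fun ω => ∏ i, f (ω i)) := by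
  refine Measure.pi_eq fun s hs => ?_
  rw [withDensity_apply _ (MeasurableSet.univ_pi hs), ← lintegral_indicator (MeasurableSet.univ_pi hs)]
  have : ∀ ω : Fin N → α, (Set.pi univ s).indicator (fun ω => ∏ i, f (ω i)) ω
      = ∏ i, (s i).indicator f (ω i) := by
    intro ω
    by_cases h : ω ∈ Set.pi univ s
    · rw [indicator_of_mem h]
      exact Finset.prod_congr rfl fun i _ => (indicator_of_mem (h i (mem_univ i)) f).symm
    · rw [indicator_of_notMem h]
      simp only [Set.mem_pi, mem_univ, true_imp_iff, not_forall] at h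
      obtain ⟨i, hi⟩ := h
      exact (Finset.prod_eq_zero (Finset.mem_univ i) (indicator_of_notMem hi f)).symm
  simp_rw [this]
  rw [lintegral_pi_prod P (fun i => (s i).indicator f) (fun i => hf.indicator (hs i))]
  refine Finset.prod_congr rfl fun i _ => ?_
  rw [lintegral_indicator (hs i), withDensity_apply _ (hs i)]

lemma wlln {α : Type*} [MeasurableSpace α] (Q : Measure α) [IsProbabilityMeasure Q]
    (g : α → ℝ) (hg : Measurable g) (hi : Integrable g Q) {V : Set ℝ} (hV : V ∈ 𝓝 (∫ x, g x ∂Q)) :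
    Tendsto (fun N : ℕ => (Measure.pi fun _ : Fin N => Q) {ω | (∑ i, g (ω i)) / N ∉ V})
      atTop (𝓝 0) := by
  obtain ⟨ε, hε, hεV⟩ := Metric.mem_nhds_iff.1 hV
  have hslln := ProbabilityTheory.strong_law_ae_real (μ := Measure.infinitePi fun _ : ℕ => Q)
    (fun i ω => g (ω i)) ?_ ?_ ?_
  · have hmean : ∫ ω, g (ω 0) ∂(Measure.infinitePi fun _ : ℕ => Q) = ∫ x, g x ∂Q := by
      have h := Measure.infinitePi_map_eval (fun _ : ℕ => Q) 0
      conv_rhs => rw [← h]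
      rw [integral_map (measurable_pi_apply 0).aemeasurable hg.aestronglyMeasurable]
    rw [hmean] at hslln
    have htm := tendstoInMeasure_of_tendsto_ae (μ := Measure.infinitePi fun _ : ℕ => Q)
      (f := fun (n : ℕ) ω => (∑ i ∈ Finset.range n, g (ω i)) / n) (g := fun _ => ∫ x, g x ∂Q)
      (fun n => Measurable.aestronglyMeasurable (by fun_prop)) hslln
    rw [tendstoInMeasure_iff_dist] at htm
    refine tendsto_of_tendsto_of_tendsto_of_le_of_le tendsto_const_nhds (htm ε hε)
      (fun _ => zero_le) (fun N => ?_)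
    have hmap : (Measure.infinitePi fun _ : ℕ => Q).map (fun x (i : Fin N) => x (i : ℕ))
        = Measure.pi fun _ : Fin N => Q := by
      rw [← Measure.infinitePi_eq_pi]
      exact Measure.map_infinitePi_infinitePi_of_inj (f := fun i : Fin N => (i : ℕ)) Fin.val_injective
    have hms : MeasurableSet {ω : Fin N → α | (∑ i, g (ω i)) / N ∉ ball (∫ x, g x ∂Q) ε} := by
      have : Measurable fun ω : Fin N → α => (∑ i, g (ω i)) / N := by fun_prop
      exact (this isOpen_ball.measurableSet).compl
    calc _ ≤ (Measure.pi fun _ : Fin N => Q) {ω | (∑ i, g (ω i)) / N ∉ ball (∫ x, g x ∂Q) ε} :=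
          measure_mono fun ω hω => by
            simp only [mem_ofPred_eq] at hω ⊢
            exact fun h => hω (hεV h)
      _ = _ := by
          rw [← hmap, Measure.map_apply (by fun_prop) hms]
          congr 1
          ext ω
          simp [Finset.sum_range]
  · have h := (measurePreserving_eval_infinitePi (fun _ : ℕ => Q) 0).integrable_comp hi.aestronglyMeasurable
    exact h.2 hi
  · intro i j hij
    exact (ProbabilityTheory.iIndepFun_infinitePi (P := fun _ : ℕ => Q) (X := fun _ => g)
      (fun _ => hg)).indepFun hij
  · intro i
    have h : ∀ i : ℕ, (Measure.infinitePi fun _ : ℕ => Q).map (fun ω => g (ω i)) = Q.map g := by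
      intro i
      conv_rhs => rw [← Measure.infinitePi_map_eval (fun _ : ℕ => Q) i]
      rw [Measure.map_map hg (measurable_pi_apply i)]
      rfl
    exact ⟨(hg.comp (measurable_pi_apply i)).aemeasurable,
      (hg.comp (measurable_pi_apply 0)).aemeasurable, by rw [h, h]⟩

lemma integral_empPM {n : ℕ} {N : ℕ} (hN : N ≠ 0) (ω : Fin N → Euc n) (φ : Euc n → ℝ) :
    ∫ x, φ x ∂(Dro.empPM N ω : Measure (Euc n)) = (∑ i, φ (ω i)) / N := by
  have : (Dro.empPM N ω : Measure (Euc n)) = Dro.empMeas ω := by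
    simp [Dro.empPM, hN]
  rw [this, Dro.empMeas, integral_smul_measure, integral_finsetSum_measure]
  · simp [integral_dirac, div_eq_inv_mul]
  · intro i _
    exact integrable_dirac (by simp)

/-- Empirical measures converge in probability. -/
lemma emp_tendsto {n : ℕ} (Q : ProbabilityMeasure (Euc n)) {U : Set (ProbabilityMeasure (Euc n))}
    (hU : U ∈ 𝓝 Q) :
    Tendsto (fun N : ℕ => Dro.prodMeas Q N {ω | Dro.empPM N ω ∉ U}) atTop (𝓝 0) := by
  let G : Filter (ProbabilityMeasure (Euc n)) :=
    { sets := {U | Tendsto (fun N : ℕ => Dro.prodMeas Q N {ω | Dro.empPM N ω ∉ U}) atTop (𝓝 0)}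
      univ_sets := by simp
      sets_of_superset := by
        intro A B hA hAB
        exact tendsto_of_tendsto_of_tendsto_of_le_of_le tendsto_const_nhds hA
          (fun _ => zero_le) (fun N => measure_mono fun ω hω => by
            simp only [mem_ofPred_eq] at hω ⊢
            exact fun h => hω (hAB h))
      inter_sets := by
        intro A B hA hB
        have hAB := Tendsto.add (Set.mem_ofPred_eq ▸ hA) (Set.mem_ofPred_eq ▸ hB)
        rw [add_zero] at hAB
        refine tendsto_of_tendsto_of_tendsto_of_le_of_le tendsto_const_nhds hAB
          (fun _ => zero_le) (fun N => ?_)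
        refine (measure_mono ?_).trans (measure_union_le _ _)
        intro ω hω
        by_contra h
        simp only [mem_union, mem_ofPred_eq, not_or, not_not] at h
        exact hω h }
  have hG : Tendsto id G (𝓝 Q) := by
    rw [ProbabilityMeasure.tendsto_iff_forall_integral_tendsto]
    intro φ V hV
    have h := wlln (Q : Measure (Euc n)) φ φ.continuous.measurable (φ.integrable _) hV
    change Tendsto _ _ _
    refine h.congr' ?_
    filter_upwards [eventually_ne_atTop 0] with N hN
    unfold Dro.prodMeas
    congr 1
    ext ω
    simp only [mem_ofPred_eq, mem_preimage, id]
    rw [integral_empPM hN]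
  exact hG hU

lemma isCompact_PMOn {n : ℕ} {S : Set (Euc n)} (hS : IsCompact S) : IsCompact (Dro.PMOn S) := by
  have h := isCompact_setOfPred_probabilityMeasure_mass_eq_compl_isCompact_le (u := fun _ => 0)
    (K := fun _ => S) tendsto_const_nhds (fun _ => hS) (Or.inr monotone_const)
  convert h using 1
  ext μ
  simp only [Dro.PMOn, mem_ofPred_eq, nonpos_iff_eq_zero, forall_const]
  rw [← prob_compl_eq_zero_iff hS.measurableSet, ProbabilityMeasure.null_iff_toMeasure_null]

end DroAux

open MeasureTheory Set Filter Metric Topology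
open scoped ENNReal NNReal
namespace DroAux

/-- Sanov-type lower bound. -/
lemma rate_lower {n : ℕ} (P Q : ProbabilityMeasure (Euc n)) (h : Euc n → ℝ) (hm : Measurable h)
    (hpos : ∀ x, 0 < h x)
    (hQ : (Q : Measure (Euc n)) = (P : Measure (Euc n)).withDensity fun x => ENNReal.ofReal (h x))
    (h_int : Integrable (fun x => Real.log (h x)) (Q : Measure (Euc n))) {r : ℝ}
    (hk : ∫ x, Real.log (h x) ∂(Q : Measure (Euc n)) < r)
    {U : Set (ProbabilityMeasure (Euc n))} (hU : U ∈ 𝓝 Q)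
    (E : (N : ℕ) → Set (Fin N → Euc n)) (hE : ∀ N, {ω | Dro.empPM N ω ∈ U} ⊆ E N) :
    ¬ Dro.rate P E ≤ ((-r : ℝ) : EReal) := by
  obtain ⟨k', hk1, hk2⟩ := exists_between hk
  obtain ⟨k'', hk3, hk4⟩ := exists_between hk2
  have b1 := wlln (Q : Measure (Euc n)) (fun x => Real.log (h x)) (by fun_prop) h_int
    (Iio_mem_nhds hk1)
  have b2 := emp_tendsto Q hU
  have h4 : (0 : ℝ≥0∞) < 4⁻¹ := by simp
  have e1 := b1.eventually (gt_mem_nhds h4)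
  have e2 := b2.eventually (gt_mem_nhds h4)
  have key : ∀ᶠ N : ℕ in atTop, ((-k'' : ℝ) : EReal) ≤
      (((N : ℝ)⁻¹ : ℝ) : EReal) * ENNReal.log (Dro.prodMeas P N (E N)) := by
    filter_upwards [e1, e2, eventually_gt_atTop 0,
      tendsto_natCast_atTop_atTop.eventually (eventually_ge_atTop (Real.log 2 / (k'' - k')))]
      with N h1 h2 hN hN2
    have hN' : (0 : ℝ) < N := by exact_mod_cast hN
    set PN := Dro.prodMeas P N with hPN
    have hQN : Dro.prodMeas Q N = PN.withDensity (fun ω => ∏ i, ENNReal.ofReal (h (ω i))) := by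
      rw [hPN]
      unfold Dro.prodMeas
      have : IsProbabilityMeasure
          ((P : Measure (Euc n)).withDensity fun x => ENNReal.ofReal (h x)) := by
        rw [← hQ]; infer_instance
      rw [hQ]
      exact pi_withDensity (P : Measure (Euc n)) (fun x => ENNReal.ofReal (h x)) (by fun_prop)
    have hprobQ : IsProbabilityMeasure (Dro.prodMeas Q N) := by
      unfold Dro.prodMeas; infer_instance
    have hprod : ∀ ω : Fin N → Euc n, ∏ i, ENNReal.ofReal (h (ω i))
        = ENNReal.ofReal (Real.exp (∑ i, Real.log (h (ω i)))) := by
      intro ω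
      rw [Real.exp_sum, ENNReal.ofReal_prod_of_nonneg (fun i _ => (Real.exp_pos _).le)]
      refine Finset.prod_congr rfl fun i _ => ?_
      rw [Real.exp_log (hpos _)]
    let G : Set (Fin N → Euc n) := {ω | (∑ i, Real.log (h (ω i))) / N ∈ Iio k'}
    have hG : MeasurableSet G := by
      have : Measurable fun ω : Fin N → Euc n => (∑ i, Real.log (h (ω i))) / N := by fun_prop
      exact this measurableSet_Iio
    let T := toMeasurable PN (E N)
    have hT : MeasurableSet T := measurableSet_toMeasurable _ _
    have c1 : Dro.prodMeas Q N (G ∩ T) ≤ ENNReal.ofReal (Real.exp (N * k')) * PN (E N) := by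
      rw [hQN, withDensity_apply _ (hG.inter hT)]
      calc _ ≤ ∫⁻ ω in G ∩ T, ENNReal.ofReal (Real.exp (N * k')) ∂PN := by
            refine setLIntegral_mono' (hG.inter hT) fun ω hω => ?_
            rw [hprod]
            refine ENNReal.ofReal_le_ofReal (Real.exp_le_exp.2 ?_)
            have : (∑ i, Real.log (h (ω i))) / N < k' := hω.1
            rw [div_lt_iff₀ hN'] at this
            linarith
        _ = ENNReal.ofReal (Real.exp (N * k')) * PN (G ∩ T) := by simp
        _ ≤ ENNReal.ofReal (Real.exp (N * k')) * PN (E N) := by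
            exact mul_le_mul' le_rfl ((measure_mono inter_subset_right).trans
              (measure_toMeasurable (μ := PN) (E N)).le)
    have c2 : (1 : ℝ≥0∞) ≤ Dro.prodMeas Q N (G ∩ T) + (4⁻¹ + 4⁻¹) := by
      have : (univ : Set (Fin N → Euc n)) ⊆ (G ∩ T) ∪
          ({ω | (∑ i, Real.log (h (ω i))) / N ∉ Iio k'} ∪ {ω | Dro.empPM N ω ∉ U}) := by
        intro ω _
        by_cases a : (∑ i, Real.log (h (ω i))) / N ∈ Iio k'
        · by_cases b : Dro.empPM N ω ∈ U
          · exact Or.inl ⟨a, subset_toMeasurable _ _ (hE N b)⟩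
          · exact Or.inr (Or.inr b)
        · exact Or.inr (Or.inl a)
      calc (1 : ℝ≥0∞) = Dro.prodMeas Q N univ := measure_univ.symm
        _ ≤ _ := measure_mono this
        _ ≤ _ := measure_union_le _ _
        _ ≤ _ := by
            gcongr
            refine (measure_union_le _ _).trans ?_
            exact add_le_add h1.le h2.le
    have c3 : ENNReal.ofReal (1/2) ≤ ENNReal.ofReal (Real.exp (N * k')) * PN (E N) := by
      refine le_trans ?_ c1
      have h22 : (4⁻¹ : ℝ≥0∞) + 4⁻¹ = ENNReal.ofReal (1/2) := by
        rw [show (4⁻¹ : ℝ≥0∞) = ENNReal.ofReal (1/4) by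
          rw [one_div, ENNReal.ofReal_inv_of_pos (by norm_num)]; norm_num,
          ← ENNReal.ofReal_add (by norm_num) (by norm_num)]
        norm_num
      rw [h22] at c2
      have h33 : (1 : ℝ≥0∞) = ENNReal.ofReal (1/2) + ENNReal.ofReal (1/2) := by
        rw [← ENNReal.ofReal_add (by norm_num) (by norm_num)]; norm_num
      rw [h33] at c2
      exact (ENNReal.add_le_add_iff_right ENNReal.ofReal_ne_top).1 c2
    have c4 : ENNReal.ofReal (Real.exp (-(N * k') - Real.log 2)) ≤ PN (E N) := by
      have : ENNReal.ofReal (Real.exp (-(N * k'))) * ENNReal.ofReal (1/2) ≤ PN (E N) := by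
        calc _ ≤ ENNReal.ofReal (Real.exp (-(N * k'))) *
              (ENNReal.ofReal (Real.exp (N * k')) * PN (E N)) := by gcongr
          _ = PN (E N) := by
              rw [← mul_assoc, ← ENNReal.ofReal_mul (Real.exp_pos _).le, ← Real.exp_add]
              simp
      refine le_trans (le_of_eq ?_) this
      rw [← ENNReal.ofReal_mul (Real.exp_pos _).le, Real.exp_sub, Real.exp_log (by norm_num)]
      congr 1; ring
    have c5 : ((-(N * k') - Real.log 2 : ℝ) : EReal) ≤ ENNReal.log (PN (E N)) := by
      have := ENNReal.log_monotone c4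
      rwa [ENNReal.log_ofReal_of_pos (Real.exp_pos _), Real.log_exp] at this
    calc ((-k'' : ℝ) : EReal) ≤ (((N : ℝ)⁻¹ * (-(N * k') - Real.log 2) : ℝ) : EReal) := by
          rw [EReal.coe_le_coe_iff]
          rw [div_le_iff₀ (by linarith)] at hN2
          rw [inv_mul_eq_div, le_div_iff₀ hN']
          nlinarith
      _ = (((N : ℝ)⁻¹ : ℝ) : EReal) * ((-(N * k') - Real.log 2 : ℝ) : EReal) := by
          rw [EReal.coe_mul]
      _ ≤ _ := by
          refine mul_le_mul_of_nonneg_left c5 ?_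
          exact_mod_cast (inv_pos.2 hN').le
  intro hle
  have := le_limsup_of_frequently_le key.frequently
  have h5 := this.trans hle
  rw [EReal.coe_le_coe_iff] at h5
  linarith

lemma mix_density {n : ℕ} (Ph P : ProbabilityMeasure (Euc n)) {r : ℝ} (hr : 0 < r)
    (hkl : Dro.klDiv (Ph : Measure (Euc n)) (P : Measure (Euc n)) ≤ ENNReal.ofReal r)
    {s : ℝ} (hs : s ∈ Icc (0:ℝ) 1) (hs0 : 0 < s) (hs1 : s < 1) :
    ∃ h : Euc n → ℝ, Measurable h ∧ (∀ x, 0 < h x) ∧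
      ((Dro.mixPM s hs Ph P : ProbabilityMeasure (Euc n)) : Measure (Euc n))
        = (P : Measure (Euc n)).withDensity (fun x => ENNReal.ofReal (h x)) ∧
      Integrable (fun x => Real.log (h x))
        ((Dro.mixPM s hs Ph P : ProbabilityMeasure (Euc n)) : Measure (Euc n)) ∧
      ∫ x, Real.log (h x) ∂((Dro.mixPM s hs Ph P : ProbabilityMeasure (Euc n)) : Measure (Euc n))
        < r := by
  have hpP : IsProbabilityMeasure (P : Measure (Euc n)) := P.2
  have hpPh : IsProbabilityMeasure (Ph : Measure (Euc n)) := Ph.2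
  have hdec : (Ph : Measure (Euc n)).HaveLebesgueDecomposition (P : Measure (Euc n)) :=
    Measure.haveLebesgueDecomposition_of_sigmaFinite _ _
  unfold Dro.klDiv at hkl
  split_ifs at hkl with hc
  swap
  · exact absurd hkl (by simp)
  obtain ⟨hac, hi⟩ := hc
  rw [ENNReal.ofReal_le_ofReal_iff hr.le] at hkl
  set f : Euc n → ℝ := fun x => ((Ph : Measure (Euc n)).rnDeriv (P : Measure (Euc n)) x).toReal
    with hf
  have hfm : Measurable f := (Measure.measurable_rnDeriv _ _).ennreal_toReal
  have hf0 : ∀ x, 0 ≤ f x := fun x => ENNReal.toReal_nonneg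
  have hpos : ∀ x, 0 < s * f x + (1 - s) := fun x => by
    have := mul_nonneg hs0.le (hf0 x); linarith
  have hhm : Measurable fun x => s * f x + (1 - s) := by fun_prop
  have hQ : ((Dro.mixPM s hs Ph P : ProbabilityMeasure (Euc n)) : Measure (Euc n))
        = (P : Measure (Euc n)).withDensity (fun x => ENNReal.ofReal (s * f x + (1 - s))) := by
    have e1 : (P : Measure (Euc n)).withDensity (fun x => ENNReal.ofReal (s * f x + (1 - s)))
        = (P : Measure (Euc n)).withDensity
          ((ENNReal.ofReal s • (Ph : Measure (Euc n)).rnDeriv (P : Measure (Euc n)))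
            + fun _ => ENNReal.ofReal (1 - s)) := by
      refine withDensity_congr_ae ?_
      filter_upwards [Measure.rnDeriv_lt_top (Ph : Measure (Euc n)) (P : Measure (Euc n))] with x hx
      rw [ENNReal.ofReal_add (mul_nonneg hs0.le (hf0 x)) (by linarith),
        ENNReal.ofReal_mul hs0.le, hf]
      simp [ENNReal.ofReal_toReal hx.ne]
    rw [e1, withDensity_add_right _ measurable_const,
      withDensity_smul _ (Measure.measurable_rnDeriv _ _), Measure.withDensity_rnDeriv_eq _ _ hac,
      withDensity_const]
    rfl
  have hfi : Integrable (fun x => f x * Real.log (f x)) (P : Measure (Euc n)) :=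
    (integrable_rnDeriv_smul_iff hac).2 hi
  have hfe : ∫ x, f x * Real.log (f x) ∂(P : Measure (Euc n))
      = ∫ x, Real.log (f x) ∂(Ph : Measure (Euc n)) := integral_rnDeriv_smul hac
  have hup : ∀ x, (s * f x + (1 - s)) * Real.log (s * f x + (1 - s))
      ≤ s * (f x * Real.log (f x)) := by
    intro x
    have := Real.convexOn_mul_log.2 (show f x ∈ Ici (0:ℝ) from mem_Ici.2 (hf0 x))
      (show (1:ℝ) ∈ Ici (0:ℝ) from mem_Ici.2 zero_le_one) hs0.le (sub_nonneg.2 hs1.le) (by ring)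
    simpa using this
  have hlo : ∀ x, -1 ≤ (s * f x + (1 - s)) * Real.log (s * f x + (1 - s)) := by
    intro x
    have h1 := Real.one_sub_inv_le_log_of_pos (hpos x)
    have h2 := mul_le_mul_of_nonneg_left h1 (hpos x).le
    rw [mul_sub, mul_inv_cancel₀ (hpos x).ne'] at h2
    have := hpos x
    linarith
  have hhi : Integrable (fun x => (s * f x + (1 - s)) * Real.log (s * f x + (1 - s)))
      (P : Measure (Euc n)) := by
    refine Integrable.mono' (hfi.norm.add (integrable_const (1:ℝ)))
      (hhm.mul hhm.log).aestronglyMeasurable (ae_of_all _ fun x => ?_)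
    rw [Real.norm_eq_abs, abs_le]
    have h3 := hup x
    have h4 := hlo x
    have h5 := le_abs_self (f x * Real.log (f x))
    have h6 := abs_nonneg (f x * Real.log (f x))
    simp only [Pi.add_apply, Real.norm_eq_abs]
    constructor
    · linarith
    · nlinarith
  refine ⟨fun x => s * f x + (1 - s), hhm, hpos, hQ, ?_, ?_⟩
  · rw [hQ, integrable_withDensity_iff_integrable_smul₀' (by fun_prop)
      (ae_of_all _ fun x => ENNReal.ofReal_lt_top)]
    refine hhi.congr (ae_of_all _ fun x => ?_)
    simp [ENNReal.toReal_ofReal (hpos x).le]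
  · rw [hQ, integral_withDensity_eq_integral_toReal_smul₀ (by fun_prop)
      (ae_of_all _ fun x => ENNReal.ofReal_lt_top)]
    calc _ = ∫ x, (s * f x + (1 - s)) * Real.log (s * f x + (1 - s)) ∂(P : Measure (Euc n)) := by
          refine integral_congr_ae (ae_of_all _ fun x => ?_)
          simp [ENNReal.toReal_ofReal (hpos x).le]
      _ ≤ ∫ x, s * (f x * Real.log (f x)) ∂(P : Measure (Euc n)) :=
          integral_mono hhi (hfi.const_mul s) hup
      _ = s * ∫ x, Real.log (f x) ∂(Ph : Measure (Euc n)) := by rw [integral_const_mul, hfe]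
      _ ≤ s * r := by gcongr
      _ < r := by nlinarith

lemma integral_mix {n : ℕ} (Ph P : ProbabilityMeasure (Euc n)) {s : ℝ} (hs : s ∈ Icc (0:ℝ) 1)
    (φ : BoundedContinuousFunction (Euc n) ℝ) :
    ∫ x, φ x ∂((Dro.mixPM s hs Ph P : ProbabilityMeasure (Euc n)) : Measure (Euc n))
      = s * ∫ x, φ x ∂(Ph : Measure (Euc n)) + (1 - s) * ∫ x, φ x ∂(P : Measure (Euc n)) := by
  change ∫ x, φ x ∂(ENNReal.ofReal s • (Ph : Measure (Euc n))
    + ENNReal.ofReal (1 - s) • (P : Measure (Euc n))) = _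
  rw [integral_add_measure ((φ.integrable _).smul_measure ENNReal.ofReal_ne_top)
    ((φ.integrable _).smul_measure ENNReal.ofReal_ne_top), integral_smul_measure,
    integral_smul_measure, ENNReal.toReal_ofReal hs.1, ENNReal.toReal_ofReal (sub_nonneg.2 hs.2)]
  simp

lemma exists_strict {n : ℕ} (D : ProbabilityMeasure (Euc n) → ProbabilityMeasure (Euc n) → ℝ≥0∞)
    (hDlsc : LowerSemicontinuous fun p : ProbabilityMeasure (Euc n) ×
        ProbabilityMeasure (Euc n) => D p.1 p.2) (η : ℝ≥0∞)
    (Ph P : ProbabilityMeasure (Euc n)) (hD : η < D Ph P) :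
    ∃ s, ∃ hs : s ∈ Icc (0:ℝ) 1, 0 < s ∧ s < 1 ∧ η < D (Dro.mixPM s hs Ph P) P := by
  let s : ℕ → ℝ := fun k => 1 - 1 / ((k : ℝ) + 2)
  have hk : ∀ k : ℕ, 0 < 1 / ((k : ℝ) + 2) ∧ 1 / ((k : ℝ) + 2) < 1 := fun k =>
    ⟨by positivity, by rw [div_lt_one (by positivity)]; have : (0:ℝ) ≤ k := k.cast_nonneg; linarith⟩
  have hs0 : ∀ k, 0 < s k := fun k => by have := (hk k).2; simp only [s]; linarith
  have hs1 : ∀ k, s k < 1 := fun k => by have := (hk k).1; simp only [s]; linarith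
  have hs : ∀ k, s k ∈ Icc (0:ℝ) 1 := fun k => ⟨(hs0 k).le, (hs1 k).le⟩
  have hlim : Tendsto s atTop (𝓝 1) := by
    have h1 : Tendsto (fun k : ℕ => 1 / ((k : ℝ) + 2)) atTop (𝓝 0) := by
      simp only [one_div]
      exact tendsto_inv_atTop_zero.comp
        (tendsto_atTop_add_const_right _ _ tendsto_natCast_atTop_atTop)
    simpa only [sub_zero] using h1.const_sub 1
  have hT : Tendsto (fun k => Dro.mixPM (s k) (hs k) Ph P) atTop (𝓝 Ph) := by
    rw [ProbabilityMeasure.tendsto_iff_forall_integral_tendsto]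
    intro φ
    simp_rw [integral_mix]
    have := (hlim.mul_const (∫ x, φ x ∂(Ph : Measure (Euc n)))).add
      ((hlim.const_sub 1).mul_const (∫ x, φ x ∂(P : Measure (Euc n))))
    simpa using this
  have hT2 : Tendsto (fun k => (Dro.mixPM (s k) (hs k) Ph P, P)) atTop (𝓝 (Ph, P)) :=
    hT.prodMk_nhds tendsto_const_nhds
  obtain ⟨k, hk⟩ := (hT2.eventually (hDlsc (Ph, P) η hD)).exists
  exact ⟨s k, hs k, hs0 k, hs1 k, hk⟩

lemma separate {n : ℕ} {B : Set (ProbabilityMeasure (Euc n))} (hB : IsCompact B)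
    (hconv : Dro.IsConvexPM B) (P : ProbabilityMeasure (Euc n)) (hP : P ∉ B) :
    ∃ (φ : BoundedContinuousFunction (Euc n) ℝ) (c : ℝ),
      (∀ P' ∈ B, ∫ x, φ x ∂(P' : Measure (Euc n)) < c) ∧ c < ∫ x, φ x ∂(P : Measure (Euc n)) := by
  classical
  obtain ⟨t, ht⟩ := hB.elim_finite_subcover
    (fun φ : BoundedContinuousFunction (Euc n) ℝ =>
      {P' : ProbabilityMeasure (Euc n) | ∫ x, φ x ∂(P' : Measure (Euc n))
        ≠ ∫ x, φ x ∂(P : Measure (Euc n))})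
    (fun φ => by
      have := ProbabilityMeasure.continuous_integral_boundedContinuousFunction φ
      exact isOpen_ne_fun this continuous_const)
    (by
      intro P' hP'
      by_contra h
      simp only [mem_iUnion, mem_ofPred_eq, not_exists, not_not] at h
      have h2 := ext_of_forall_integral_eq_of_IsFiniteMeasure h
      exact hP ((Subtype.ext h2 : P' = P) ▸ hP'))
  let T : ProbabilityMeasure (Euc n) → (t → ℝ) := fun P' φ =>
    ∫ x, (φ : BoundedContinuousFunction (Euc n) ℝ) x ∂(P' : Measure (Euc n))
  have hTc : Continuous T := continuous_pi fun φ =>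
    ProbabilityMeasure.continuous_integral_boundedContinuousFunction φ.1
  have hcl : IsClosed (T '' B) := (hB.image hTc).isClosed
  have hcv : Convex ℝ (T '' B) := by
    rintro _ ⟨μ, hμ, rfl⟩ _ ⟨ν, hν, rfl⟩ a b ha hb hab
    refine ⟨Dro.mixPM a ⟨ha, by linarith⟩ μ ν, hconv μ hμ ν hν a ⟨ha, by linarith⟩, ?_⟩
    funext φ
    have hm := integral_mix μ ν (s := a) ⟨ha, by linarith⟩ φ.1
    have e : b = 1 - a := by linarith
    subst e
    exact hm
  have hni : T P ∉ T '' B := by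
    rintro ⟨P', hP', he⟩
    have := ht hP'
    simp only [mem_iUnion, mem_ofPred_eq] at this
    obtain ⟨φ, hφ, hne⟩ := this
    exact hne (congrFun he ⟨φ, hφ⟩)
  obtain ⟨f, u, h1, h2⟩ := geometric_hahn_banach_closed_point hcv hcl hni
  have hrep : ∀ P' : ProbabilityMeasure (Euc n),
      ∫ x, (∑ φ : t, f (Pi.single φ 1) • (φ : BoundedContinuousFunction (Euc n) ℝ)) x
        ∂(P' : Measure (Euc n)) = f (T P') := by
    intro P'
    have hc : ∀ x, (∑ φ : t, f (Pi.single φ 1) • (φ : BoundedContinuousFunction (Euc n) ℝ)) x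
        = ∑ φ : t, f (Pi.single φ 1) * (φ : BoundedContinuousFunction (Euc n) ℝ) x := by
      intro x
      simp
    simp_rw [hc]
    rw [integral_finsetSum _ (fun φ _ => ((φ.1).integrable _).const_mul _)]
    simp_rw [integral_const_mul]
    have := LinearMap.pi_apply_eq_sum_univ f.toLinearMap (T P')
    simp only [ContinuousLinearMap.coe_coe] at this
    rw [this]
    refine Finset.sum_congr rfl fun φ _ => ?_
    rw [smul_eq_mul, mul_comm]
    congr 2
    funext j
    simp [Pi.single_apply, eq_comm]
  exact ⟨_, u, fun P' hP' => by rw [hrep]; exact h1 _ ⟨P', hP', rfl⟩, by rw [hrep]; exact h2⟩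

lemma not_ptFeasible {n : ℕ} {X : Type*} [Nonempty X]
    (S : Set (Euc n)) (hS : IsCompact S)
    (D : ProbabilityMeasure (Euc n) → ProbabilityMeasure (Euc n) → ℝ≥0∞)
    (hDconv : ∀ t, ∀ ht : t ∈ Set.Icc (0:ℝ) 1, ∀ μ₁ ν₁ μ₂ ν₂,
      D (Dro.mixPM t ht μ₁ μ₂) (Dro.mixPM t ht ν₁ ν₂)
        ≤ ENNReal.ofReal t * D μ₁ ν₁ + ENNReal.ofReal (1 - t) * D μ₂ ν₂)
    (hDlsc : LowerSemicontinuous fun p : ProbabilityMeasure (Euc n) ×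
        ProbabilityMeasure (Euc n) => D p.1 p.2)
    (r : ℝ) (η : ℝ≥0∞) (hη : η < Dro.Rad D S r) (hr : 0 < r) :
    ∃ ℓ₀ : Euc n → ℝ, ContinuousOn ℓ₀ S ∧
        ¬ Dro.PtFeasible S (fun _ : X => ℓ₀) (Dro.cDist D S (fun _ : X => ℓ₀) η) r := by
  obtain ⟨_, ⟨Ph, hPh, P, hP, hkl, rfl⟩, hD⟩ := lt_sSup_iff.1 hη
  obtain ⟨s, hs, hs0, hs1, hD'⟩ := exists_strict D hDlsc η Ph P hD
  obtain ⟨h, hm, hpos, hQ, h_int, hlt⟩ := mix_density Ph P hr hkl hs hs0 hs1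
  set Q := Dro.mixPM s hs Ph P with hQdef
  have hSc := isCompact_PMOn hS
  let B : Set (ProbabilityMeasure (Euc n)) := Dro.PMOn S ∩ {P' | D Q P' ≤ η}
  have hBc : IsCompact B := by
    refine hSc.inter_right ?_
    have h1 : IsClosed {p : ProbabilityMeasure (Euc n) × ProbabilityMeasure (Euc n) |
        D p.1 p.2 ≤ η} := hDlsc.isClosed_preimage η
    exact h1.preimage (Continuous.prodMk_right Q)
  have hBconv : Dro.IsConvexPM B := by
    intro μ hμ ν hν t ht
    refine ⟨?_, ?_⟩
    · have h1 : (μ : Measure (Euc n)) S = 1 := hμ.1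
      have h2 : (ν : Measure (Euc n)) S = 1 := hν.1
      change (ENNReal.ofReal t • (μ : Measure (Euc n))
        + ENNReal.ofReal (1 - t) • (ν : Measure (Euc n))) S = 1
      rw [Measure.add_apply, Measure.smul_apply, Measure.smul_apply, h1, h2]
      simp only [smul_eq_mul, mul_one]
      rw [← ENNReal.ofReal_add ht.1 (sub_nonneg.2 ht.2)]
      simp
    · have h1 := hDconv t ht Q μ Q ν
      have hsum : ENNReal.ofReal t + ENNReal.ofReal (1 - t) = 1 := by
        rw [← ENNReal.ofReal_add ht.1 (sub_nonneg.2 ht.2)]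
        simp
      have h2 : Dro.mixPM t ht Q Q = Q := by
        apply Subtype.ext
        change ENNReal.ofReal t • (Q : Measure (Euc n))
          + ENNReal.ofReal (1 - t) • (Q : Measure (Euc n)) = Q
        rw [← add_smul, hsum, one_smul]
      rw [h2] at h1
      refine h1.trans ?_
      calc _ ≤ ENNReal.ofReal t * η + ENNReal.ofReal (1 - t) * η := by
            gcongr
            · exact hμ.2
            · exact hν.2
        _ = η := by rw [← add_mul, hsum, one_mul]
  have hPB : P ∉ B := fun h => absurd hD' (not_lt.2 h.2)
  obtain ⟨φ, c, hc1, hc2⟩ := separate hBc hBconv P hPB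
  have hφc := ProbabilityMeasure.continuous_integral_boundedContinuousFunction φ
  let K : Set (ProbabilityMeasure (Euc n)) :=
    Dro.PMOn S ∩ {P' | c ≤ ∫ x, φ x ∂(P' : Measure (Euc n))}
  have hK : IsCompact K := hSc.inter_right (isClosed_le continuous_const hφc)
  have hopen : IsOpen {p : ProbabilityMeasure (Euc n) × ProbabilityMeasure (Euc n) |
      η < D p.1 p.2} := hDlsc.isOpen_preimage η
  obtain ⟨U, V, hU, -, hQU, hKV, hUV⟩ := generalized_tube_lemma (isCompact_singleton (x := Q)) hK
    hopen (by
      rintro ⟨a, b⟩ ⟨ha, hb⟩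
      have ha' : a = Q := ha
      rw [ha']
      by_contra hcon
      have hle : D Q b ≤ η := not_lt.1 hcon
      exact absurd (hc1 b ⟨hb.1, hle⟩) (not_lt.2 hb.2))
  set C : ℝ := 1 - ∫ x, φ x ∂(P : Measure (Euc n)) with hC
  have hcost : ∀ (x : X) (P' : ProbabilityMeasure (Euc n)),
      Dro.cost (fun _ : X => fun ξ => φ ξ + C) x P' = ∫ x, φ x ∂(P' : Measure (Euc n)) + C := by
    intro x P'
    unfold Dro.cost
    rw [integral_add (φ.integrable _) (integrable_const _)]
    simp
  refine ⟨fun ξ => φ ξ + C, (φ.continuous.add continuous_const).continuousOn, fun hfeas => ?_⟩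
  obtain ⟨x⟩ := ‹Nonempty X›
  refine rate_lower P Q h hm hpos hQ h_int hlt (hU.mem_nhds (hQU rfl)) _ ?_ (hfeas P hP x)
  intro N ω hω
  have hω' : Dro.empPM N ω ∈ U := hω
  change Dro.cost _ x P > Dro.cDist D S _ η x (Dro.empPM N ω)
  rw [hcost]
  have : Dro.cDist D S (fun _ : X => fun ξ => φ ξ + C) η x (Dro.empPM N ω) ≤ max (c + C) 0 := by
    refine Real.sSup_le ?_ (le_max_right _ _)
    rintro v ⟨P', hP', hDP, rfl⟩
    rw [hcost]
    refine le_trans ?_ (le_max_left _ _)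
    by_contra hcon
    have hK' : P' ∈ K := ⟨hP', by
      simp only [mem_ofPred_eq]
      linarith⟩
    have : η < D (Dro.empPM N ω) P' := hUV (mk_mem_prod hω' (hKV hK'))
    exact absurd this (not_lt.2 hDP)
  refine lt_of_le_of_lt this ?_
  rw [max_lt_iff]
  constructor <;> linarith

end DroAux

open MeasureTheory Set Filter Metric Topology
open scoped ENNReal NNReal
namespace DroAux

theorem exists_cells {n : ℕ} (S : Set (Euc n)) (hS : IsCompact S) (ε : ℝ) (hε : 0 < ε) :
    ∃ (κ : Type) (_ : Fintype κ) (f : Euc n → (κ → Bool)), Measurable f ∧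
      ∀ x ∈ S, ∀ y, f x = f y → dist x y ≤ ε := by
  classical
  obtain ⟨t, -, htf, hcov⟩ := hS.finite_cover_balls (half_pos hε)
  have : Finite t := htf
  let e := Finite.equivFin t
  refine ⟨Fin (Nat.card t), inferInstance,
    fun x k => decide (x ∈ ball ((e.symm k : t) : Euc n) (ε / 2)), ?_, ?_⟩
  · refine measurable_pi_iff.2 fun k => ?_
    refine measurable_to_bool ?_
    have : (fun x => decide (x ∈ ball ((e.symm k : t) : Euc n) (ε / 2))) ⁻¹' {true}
        = ball ((e.symm k : t) : Euc n) (ε / 2) := by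
      ext x; simp
    rw [this]
    exact measurableSet_ball
  · intro x hx y hxy
    obtain ⟨c, hc, hxc⟩ := mem_iUnion₂.1 (hcov hx)
    have h := congrFun hxy (e ⟨c, hc⟩)
    simp only [Equiv.symm_apply_apply, decide_eq_decide] at h
    have hy := h.1 hxc
    rw [mem_ball] at hxc hy
    have := dist_triangle_right x y c
    linarith

section Coupling
variable {n : ℕ} {S : Set (Euc n)} {ι : Type} [Fintype ι] [MeasurableSpace ι]
  [MeasurableSingletonClass ι]

theorem sum_restrict_cells (f : Euc n → ι) (hf : Measurable f) (μ : Measure (Euc n)) :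
    ∑ j, μ.restrict (f ⁻¹' {j}) = μ := by
  ext A hA
  rw [Measure.finsetSum_apply]
  have h1 := measure_biUnion_finset (μ := μ) (s := (Finset.univ : Finset ι))
    (f := fun j => A ∩ f ⁻¹' {j})
    (by
      intro a _ b _ hab
      refine Set.disjoint_left.2 fun x hx hx' => hab ?_
      exact hx.2.symm.trans hx'.2)
    (fun j _ => hA.inter (hf (measurableSet_singleton j)))
  have h2 : (⋃ j ∈ (Finset.univ : Finset ι), A ∩ f ⁻¹' {j}) = A := by
    ext x; simp
  rw [h2] at h1
  rw [h1]
  exact Finset.sum_congr rfl fun j _ => Measure.restrict_apply hA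

theorem ae_mem_of_PMOn (hS : MeasurableSet S) {P : ProbabilityMeasure (Euc n)}
    (hP : P ∈ Dro.PMOn S) : ∀ᵐ x ∂(P : Measure (Euc n)), x ∈ S :=
  (prob_compl_eq_zero_iff hS).2 hP

theorem wdist_le (hS : MeasurableSet S) (ε : ℝ) (f : Euc n → ι) (hf : Measurable f)
    (hd : ∀ x ∈ S, ∀ y, f x = f y → dist x y ≤ ε)
    (P Q : ProbabilityMeasure (Euc n)) (hP : P ∈ Dro.PMOn S)
    (hPQ : ∀ j, (P : Measure (Euc n)) (f ⁻¹' {j}) = (Q : Measure (Euc n)) (f ⁻¹' {j})) :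
    Dro.wdist (P : Measure (Euc n)) (Q : Measure (Euc n)) ≤ ENNReal.ofReal ε := by
  set p := (P : Measure (Euc n)) with hp
  set q := (Q : Measure (Euc n)) with hq
  let γ : Measure (Euc n × Euc n) :=
    ∑ j, (p (f ⁻¹' {j}))⁻¹ • (p.restrict (f ⁻¹' {j})).prod (q.restrict (f ⁻¹' {j}))
  have hfst : γ.map Prod.fst = p := by
    conv_rhs => rw [← sum_restrict_cells f hf p]
    simp only [γ]
    rw [Measure.map_finset_sum measurable_fst.aemeasurable]
    refine Finset.sum_congr rfl fun j _ => ?_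
    rw [Measure.map_smul, Measure.map_fst_prod, Measure.restrict_apply_univ, ← hPQ j, smul_smul]
    by_cases h0 : p (f ⁻¹' {j}) = 0
    · rw [Measure.restrict_eq_zero.2 h0, smul_zero]
    · rw [ENNReal.inv_mul_cancel h0 (measure_ne_top _ _), one_smul]
  have hsnd : γ.map Prod.snd = q := by
    conv_rhs => rw [← sum_restrict_cells f hf q]
    simp only [γ]
    rw [Measure.map_finset_sum measurable_snd.aemeasurable]
    refine Finset.sum_congr rfl fun j _ => ?_
    rw [Measure.map_smul, Measure.map_snd_prod, Measure.restrict_apply_univ, smul_smul]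
    by_cases h0 : p (f ⁻¹' {j}) = 0
    · rw [Measure.restrict_eq_zero.2 ((hPQ j).symm.trans h0), smul_zero]
    · rw [ENNReal.inv_mul_cancel h0 (measure_ne_top _ _), one_smul]
  refine (iInf_le_of_le γ (iInf_le_of_le hfst (iInf_le _ hsnd))).trans ?_
  have hu : γ univ = 1 := by
    have := congrArg (fun m => m univ) hfst
    simp only [Measure.map_apply measurable_fst MeasurableSet.univ, preimage_univ] at this
    rw [this]; exact measure_univ
  have hmono : ∀ᵐ z ∂γ, edist z.1 z.2 ≤ ENNReal.ofReal ε := by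
    rw [ae_iff]
    simp only [γ]
    rw [Measure.finsetSum_apply]
    refine Finset.sum_eq_zero fun j _ => ?_
    rw [Measure.smul_apply]
    suffices h : ∀ᵐ z ∂((p.restrict (f ⁻¹' {j})).prod (q.restrict (f ⁻¹' {j}))),
        edist z.1 z.2 ≤ ENNReal.ofReal ε by
      rw [ae_iff] at h
      rw [h, smul_zero]
    have hm := hf (measurableSet_singleton j)
    have a1 : ∀ᵐ x ∂(p.restrict (f ⁻¹' {j})), x ∈ S ∧ x ∈ f ⁻¹' {j} :=
      (ae_restrict_of_ae (ae_mem_of_PMOn hS hP)).and (ae_restrict_mem hm)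
    have a2 : ∀ᵐ x ∂(q.restrict (f ⁻¹' {j})), x ∈ f ⁻¹' {j} := ae_restrict_mem hm
    filter_upwards [Measure.quasiMeasurePreserving_fst.ae a1,
      Measure.quasiMeasurePreserving_snd.ae a2] with z h1 h2
    rw [edist_dist]
    exact ENNReal.ofReal_le_ofReal (hd _ h1.1 _ (h1.2.trans h2.symm))
  calc ∫⁻ z, edist z.1 z.2 ∂γ ≤ ∫⁻ _, ENNReal.ofReal ε ∂γ := lintegral_mono_ae hmono
    _ = ENNReal.ofReal ε := by rw [lintegral_const, hu, mul_one]

theorem lp_half (hS : MeasurableSet S) (ε : ℝ) (f : Euc n → ι) (hf : Measurable f)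
    (hd : ∀ x ∈ S, ∀ y, f x = f y → dist x y ≤ ε)
    (P Q : ProbabilityMeasure (Euc n)) (hP : P ∈ Dro.PMOn S)
    (hPQ : ∀ j, (P : Measure (Euc n)) (f ⁻¹' {j}) = (Q : Measure (Euc n)) (f ⁻¹' {j}))
    (A : Set (Euc n)) :
    (P : Measure (Euc n)) A ≤ (Q : Measure (Euc n)) (cthickening ε A) := by
  classical
  let J : Set ι := f '' (A ∩ S)
  have hJ : MeasurableSet J := J.toFinite.measurableSet
  have hun : ∀ R : Measure (Euc n), R (f ⁻¹' J) = ∑ j ∈ Finset.univ.filter (· ∈ J), R (f ⁻¹' {j}) := by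
    intro R
    rw [← measure_biUnion_finset]
    · congr 1; ext x; simp
    · intro a _ b _ hab
      refine Set.disjoint_left.2 fun x hx hx' => hab ?_
      exact hx.symm.trans hx'
    · exact fun j _ => hf (measurableSet_singleton j)
  calc (P : Measure (Euc n)) A ≤ (P : Measure (Euc n)) (f ⁻¹' J) := by
        refine measure_mono_ae ?_
        filter_upwards [ae_mem_of_PMOn hS hP] with x hx hxA
        exact ⟨x, ⟨hxA, hx⟩, rfl⟩
    _ = (Q : Measure (Euc n)) (f ⁻¹' J) := by
        rw [hun, hun]; exact Finset.sum_congr rfl fun j _ => hPQ j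
    _ ≤ _ := by
        refine measure_mono ?_
        rintro y ⟨x, ⟨hxA, hxS⟩, hxy⟩
        exact mem_cthickening_of_dist_le y x ε A hxA (by rw [dist_comm]; exact hd x hxS y hxy)

theorem lpDist_le (hS : MeasurableSet S) (ε : ℝ) (hε : 0 < ε) (f : Euc n → ι) (hf : Measurable f)
    (hd : ∀ x ∈ S, ∀ y, f x = f y → dist x y ≤ ε)
    (P Q : ProbabilityMeasure (Euc n)) (hP : P ∈ Dro.PMOn S) (hQ : Q ∈ Dro.PMOn S)
    (hPQ : ∀ j, (P : Measure (Euc n)) (f ⁻¹' {j}) = (Q : Measure (Euc n)) (f ⁻¹' {j})) :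
    Dro.lpDist (P : Measure (Euc n)) (Q : Measure (Euc n)) ≤ ε := by
  refine csInf_le ⟨0, fun e he => he.1.le⟩ ⟨hε, fun A _ => ⟨?_, ?_⟩⟩
  · exact (lp_half hS ε f hf hd P Q hP hPQ A).trans le_self_add
  · exact (lp_half hS ε f hf hd Q P hQ (fun j => (hPQ j).symm) A).trans le_self_add

end Coupling
end DroAux

open MeasureTheory Set Filter Metric Topology
open scoped ENNReal NNReal
namespace DroAux

section Types
variable {n : ℕ} {S : Set (Euc n)} {ι : Type} [Fintype ι] [MeasurableSpace ι]
  [MeasurableSingletonClass ι] [DecidableEq ι]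

/-- label counts -/
def cnt {N : ℕ} (f : Euc n → ι) (ω : Fin N → Euc n) (j : ι) : ℕ :=
  (Finset.univ.filter fun i => f (ω i) = j).card

theorem emp_cell {N : ℕ} (hN : N ≠ 0) (f : Euc n → ι) (hf : Measurable f)
    (ω : Fin N → Euc n) (j : ι) :
    (Dro.empPM N ω : Measure (Euc n)) (f ⁻¹' {j}) = ENNReal.ofReal ((cnt f ω j : ℝ) / N) := by
  have h1 : (Dro.empPM N ω : Measure (Euc n)) = Dro.empMeas ω := by
    simp [Dro.empPM, hN]
  rw [h1, Dro.empMeas, Measure.smul_apply, Measure.finsetSum_apply]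
  have hm := hf (measurableSet_singleton j)
  have : ∀ i, Measure.dirac (ω i) (f ⁻¹' {j}) = if f (ω i) = j then (1 : ℝ≥0∞) else 0 := by
    intro i
    rw [Measure.dirac_apply' _ hm]
    by_cases h : f (ω i) = j
    · rw [if_pos h, Set.indicator_of_mem (show ω i ∈ f ⁻¹' {j} from h)]; rfl
    · rw [if_neg h, Set.indicator_of_notMem (show ω i ∉ f ⁻¹' {j} from h)]
  simp only [this, Finset.sum_boole, smul_eq_mul]
  rw [ENNReal.ofReal_div_of_pos (by positivity), ENNReal.ofReal_natCast, ENNReal.ofReal_natCast,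
    div_eq_mul_inv, mul_comm]
  rfl

theorem emp_mem (hS : MeasurableSet S) {N : ℕ} (hN : N ≠ 0) (ω : Fin N → Euc n)
    (h : ∀ i, ω i ∈ S) : Dro.empPM N ω ∈ Dro.PMOn S := by
  have h1 : (Dro.empPM N ω : Measure (Euc n)) = Dro.empMeas ω := by
    simp [Dro.empPM, hN]
  change (Dro.empPM N ω : Measure (Euc n)) S = 1
  rw [h1, Dro.empMeas, Measure.smul_apply, Measure.finsetSum_apply]
  simp only [Measure.dirac_apply' _ hS, Set.indicator_of_mem (h _)]
  simp [ENNReal.inv_mul_cancel (Nat.cast_ne_zero.2 hN) (ENNReal.natCast_ne_top N)]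

theorem integral_cells (f : Euc n → ι) (hf : Measurable f) (μ : Measure (Euc n))
    [IsFiniteMeasure μ] (φ : ι → ℝ) :
    Integrable (fun x => φ (f x)) μ ∧ ∫ x, φ (f x) ∂μ = ∑ j, μ.real (f ⁻¹' {j}) * φ j := by
  have hφ : Measurable φ := measurable_of_finite φ
  constructor
  · exact (Integrable.of_finite (μ := μ.map f) (f := φ)).comp_measurable hf
  · rw [← integral_map hf.aemeasurable hφ.aestronglyMeasurable, integral_fintype Integrable.of_finite]
    refine Finset.sum_congr rfl fun j _ => ?_
    rw [measureReal_def, measureReal_def, Measure.map_apply hf (measurableSet_singleton j),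
      smul_eq_mul]

theorem lintegral_cells (f : Euc n → ι) (hf : Measurable f) (μ : Measure (Euc n))
    (φ : ι → ℝ≥0∞) :
    ∫⁻ x, φ (f x) ∂μ = ∑ j, φ j * μ (f ⁻¹' {j}) := by
  have hφ : Measurable φ := measurable_of_finite φ
  rw [← lintegral_map hφ hf, lintegral_fintype]
  refine Finset.sum_congr rfl fun j _ => ?_
  rw [Measure.map_apply hf (measurableSet_singleton j)]

/-- The tilted measure with prescribed cell masses. -/
theorem exists_tilt (hS : MeasurableSet S) (f : Euc n → ι) (hf : Measurable f)
    (P : ProbabilityMeasure (Euc n)) (hP : P ∈ Dro.PMOn S) (v : ι → ℝ) (hv : ∀ j, 0 ≤ v j)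
    (hv1 : ∑ j, v j = 1) (hpos : ∀ j, 0 < v j → 0 < (P : Measure (Euc n)).real (f ⁻¹' {j})) :
    ∃ Q ∈ Dro.PMOn S, (∀ j, (Q : Measure (Euc n)) (f ⁻¹' {j}) = ENNReal.ofReal (v j)) ∧
      Dro.klDiv (Q : Measure (Euc n)) (P : Measure (Euc n)) =
        ENNReal.ofReal (∑ j, v j * Real.log (v j / (P : Measure (Euc n)).real (f ⁻¹' {j}))) ∧
      ∫⁻ x, ENNReal.ofReal (v (f x) / (P : Measure (Euc n)).real (f ⁻¹' {f x}))
        ∂(P : Measure (Euc n)) = 1 := by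
  set μ := (P : Measure (Euc n)) with hμ
  let a : ι → ℝ := fun j => v j / μ.real (f ⁻¹' {j})
  have ha : ∀ j, 0 ≤ a j := fun j => div_nonneg (hv j) measureReal_nonneg
  let g : Euc n → ℝ≥0∞ := fun x => ENNReal.ofReal (a (f x))
  have hg : Measurable g := by
    have : Measurable fun j => ENNReal.ofReal (a j) := measurable_of_finite _
    exact this.comp hf
  have hmass : ∀ j, ENNReal.ofReal (a j) * μ (f ⁻¹' {j}) = ENNReal.ofReal (v j) := by
    intro j
    rw [← ofReal_measureReal (μ := μ) (s := f ⁻¹' {j}), ← ENNReal.ofReal_mul (ha j)]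
    rcases (hv j).eq_or_lt with h | h
    · simp [a, ← h]
    · congr 1
      exact div_mul_cancel₀ _ (hpos j h).ne'
  have hone : ∫⁻ x, g x ∂μ = 1 := by
    have := lintegral_cells f hf μ (fun j => ENNReal.ofReal (a j))
    simp only [g]
    rw [this]
    simp only [hmass]
    rw [← ENNReal.ofReal_sum_of_nonneg fun j _ => hv j, hv1, ENNReal.ofReal_one]
  have hQp : IsProbabilityMeasure (μ.withDensity g) := ⟨by
    rw [withDensity_apply _ MeasurableSet.univ, Measure.restrict_univ, hone]⟩
  have hcell : ∀ j, (μ.withDensity g) (f ⁻¹' {j}) = ENNReal.ofReal (v j) := by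
    intro j
    have hm := hf (measurableSet_singleton j)
    rw [withDensity_apply _ hm, setLIntegral_congr_fun hm (g := fun _ => ENNReal.ofReal (a j))
      (fun x hx => by
        have : f x = j := hx
        simp only [g, this]), setLIntegral_const, hmass]
  have hac : μ.withDensity g ≪ μ := withDensity_absolutelyContinuous _ _
  refine ⟨⟨μ.withDensity g, hQp⟩, ?_, hcell, ?_, hone⟩
  · have h1 : (μ.withDensity g) S = 1 :=
      (prob_compl_eq_zero_iff hS).1 (hac ((prob_compl_eq_zero_iff hS).2 hP))
    exact h1
  · change Dro.klDiv (μ.withDensity g) μ = _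
    have hlog : (fun x => Real.log (((μ.withDensity g).rnDeriv μ x).toReal))
        =ᵐ[μ.withDensity g] fun x => Real.log (a (f x)) := by
      have := hac.ae_le (Measure.rnDeriv_withDensity μ hg)
      filter_upwards [this] with x hx
      rw [hx]
      simp only [g]
      rw [ENNReal.toReal_ofReal (ha _)]
    obtain ⟨hi, he⟩ := integral_cells f hf (μ.withDensity g) (fun j => Real.log (a j))
    rw [Dro.klDiv, if_pos ⟨hac, hi.congr hlog.symm⟩, integral_congr_ae hlog, he]
    congr 1
    refine Finset.sum_congr rfl fun j _ => ?_
    rw [measureReal_def, hcell, ENNReal.toReal_ofReal (hv j)]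

theorem type_bound (hS : MeasurableSet S) (f : Euc n → ι) (hf : Measurable f)
    (P : ProbabilityMeasure (Euc n)) (hP : P ∈ Dro.PMOn S) (r : ℝ) {N : ℕ} (hN : N ≠ 0)
    (k : ι → ℕ) (B : Set (Fin N → Euc n)) (hBk : ∀ ω ∈ B, ∀ j, cnt f ω j = k j)
    (hB : ∀ ω ∈ B, ∀ Q ∈ Dro.PMOn S,
      (∀ j, (Dro.empPM N ω : Measure (Euc n)) (f ⁻¹' {j}) = (Q : Measure (Euc n)) (f ⁻¹' {j})) →
      ENNReal.ofReal r < Dro.klDiv (Q : Measure (Euc n)) (P : Measure (Euc n))) :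
    Dro.prodMeas P N B ≤ ENNReal.ofReal (Real.exp (-(N * r))) := by
  have hN0 : (0 : ℝ) < N := by positivity
  rcases B.eq_empty_or_nonempty with rfl | ⟨ω₀, hω₀⟩
  · simp
  by_cases hz : ∃ j, k j ≠ 0 ∧ (P : Measure (Euc n)) (f ⁻¹' {j}) = 0
  · obtain ⟨j, hkj, hj⟩ := hz
    have hsub : B ⊆ ⋃ i : Fin N, (fun ω => ω i) ⁻¹' (f ⁻¹' {j}) := by
      intro ω hω
      have := hBk ω hω j
      have h2 : (Finset.univ.filter fun i => f (ω i) = j).card ≠ 0 := by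
        rw [← cnt, this]; exact hkj
      obtain ⟨i, hi⟩ := Finset.card_ne_zero.1 h2
      exact mem_iUnion.2 ⟨i, (Finset.mem_filter.1 hi).2⟩
    have h0 : Dro.prodMeas P N B = 0 := by
      refine measure_mono_null hsub (measure_iUnion_null fun i => ?_)
      exact (Measure.quasiMeasurePreserving_eval (μ := fun _ : Fin N => (P : Measure (Euc n)))
        i).preimage_null hj
    rw [h0]; exact zero_le
  push Not at hz
  let v : ι → ℝ := fun j => (k j : ℝ) / N
  have hv : ∀ j, 0 ≤ v j := fun j => by positivity
  have hksum : ∑ j, k j = N := by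
    have := Finset.card_eq_sum_card_fiberwise (s := (Finset.univ : Finset (Fin N)))
      (t := (Finset.univ : Finset ι)) (f := fun i => f (ω₀ i)) (fun i _ => by simp)
    rw [Finset.card_univ, Fintype.card_fin] at this
    rw [this]
    exact Finset.sum_congr rfl fun j _ => (hBk ω₀ hω₀ j).symm
  have hv1 : ∑ j, v j = 1 := by
    simp only [v]
    rw [← Finset.sum_div, ← Nat.cast_sum, hksum, div_self hN0.ne']
  have hkpos : ∀ j, k j ≠ 0 → 0 < (P : Measure (Euc n)).real (f ⁻¹' {j}) := fun j hj =>
    (measureReal_nonneg).lt_of_ne' (by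
      rw [measureReal_def, ENNReal.toReal_ne_zero]
      exact ⟨hz j hj, measure_ne_top _ _⟩)
  have hpos : ∀ j, 0 < v j → 0 < (P : Measure (Euc n)).real (f ⁻¹' {j}) := by
    intro j hj
    refine hkpos j ?_
    rintro h
    simp [v, h] at hj
  obtain ⟨Q, hQS, hQc, hQk, hone⟩ := exists_tilt hS f hf P hP v hv hv1 hpos
  set p : ι → ℝ := fun j => (P : Measure (Euc n)).real (f ⁻¹' {j}) with hp
  set K : ℝ := ∑ j, v j * Real.log (v j / p j) with hK
  have hrK : r < K := by
    have h := hB ω₀ hω₀ Q hQS (fun j => by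
      rw [emp_cell hN f hf, hQc, hBk ω₀ hω₀ j])
    rw [hQk] at h
    by_contra hc
    exact absurd h (not_lt.2 (ENNReal.ofReal_le_ofReal (not_lt.1 hc)))
  let g : Euc n → ℝ≥0∞ := fun x => ENNReal.ofReal (v (f x) / p (f x))
  have hg : Measurable g := by
    have : Measurable fun j => ENNReal.ofReal (v j / p j) := measurable_of_finite _
    exact this.comp hf
  have h_int : ∫⁻ ω, ∏ i : Fin N, g (ω i) ∂(Dro.prodMeas P N) = 1 := by
    rw [Dro.prodMeas, lintegral_pi_prod (P : Measure (Euc n)) (fun _ => g) (fun _ => hg)]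
    simp only [Finset.prod_const]
    rw [show ∫⁻ x, g x ∂(P : Measure (Euc n)) = 1 from hone, one_pow]
  have hprod : ∀ ω ∈ B, ENNReal.ofReal (Real.exp (N * K)) = ∏ i : Fin N, g (ω i) := by
    intro ω hω
    have hgp : ∀ i, 0 < v (f (ω i)) / p (f (ω i)) := by
      intro i
      have hki : k (f (ω i)) ≠ 0 := by
        rw [← hBk ω hω, cnt]
        exact Finset.card_ne_zero.2 ⟨i, by simp⟩
      refine div_pos ?_ (hkpos _ hki)
      have : 0 < k (f (ω i)) := Nat.pos_of_ne_zero hki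
      simp only [v]; positivity
    have hs : ∑ i, Real.log (v (f (ω i)) / p (f (ω i))) = N * K := by
      have := Finset.sum_fiberwise' (s := (Finset.univ : Finset (Fin N)))
        (fun i => f (ω i)) (fun j => Real.log (v j / p j))
      rw [← this, hK, Finset.mul_sum]
      refine Finset.sum_congr rfl fun j _ => ?_
      rw [Finset.sum_const, nsmul_eq_mul, ← mul_assoc]
      congr 1
      have : ((Finset.univ.filter fun i => f (ω i) = j).card) = k j := hBk ω hω j
      rw [this]
      simp only [v]; field_simp
    rw [← hs, Real.exp_sum, ENNReal.ofReal_prod_of_nonneg (fun i _ => (Real.exp_pos _).le)]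
    exact Finset.prod_congr rfl fun i _ => by rw [Real.exp_log (hgp i)]
  have hM := mul_meas_ge_le_lintegral₀ (μ := Dro.prodMeas P N)
    (f := fun ω => ∏ i : Fin N, g (ω i))
    (Finset.measurable_prod _ fun i _ => hg.comp (measurable_pi_apply i)).aemeasurable
    (ENNReal.ofReal (Real.exp (N * K)))
  rw [h_int] at hM
  have hBle : ENNReal.ofReal (Real.exp (N * K)) * Dro.prodMeas P N B ≤ 1 :=
    (mul_le_mul' le_rfl (measure_mono fun ω hω => (hprod ω hω).le)).trans hM
  have hne : ENNReal.ofReal (Real.exp (N * K)) ≠ 0 := by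
    simp [ENNReal.ofReal_eq_zero, Real.exp_pos]
  calc Dro.prodMeas P N B ≤ (ENNReal.ofReal (Real.exp (N * K)))⁻¹ := by
        rw [ENNReal.le_inv_iff_mul_le, mul_comm]; exact hBle
    _ = ENNReal.ofReal (Real.exp (-(N * K))) := by
        rw [← ENNReal.ofReal_inv_of_pos (Real.exp_pos _), Real.exp_neg]
    _ ≤ _ := by
        refine ENNReal.ofReal_le_ofReal (Real.exp_le_exp.2 ?_)
        have := mul_le_mul_of_nonneg_left hrK.le hN0.le
        linarith

theorem union_bound (hS : MeasurableSet S) (f : Euc n → ι) (hf : Measurable f)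
    (P : ProbabilityMeasure (Euc n)) (hP : P ∈ Dro.PMOn S) (r : ℝ) {N : ℕ} (hN : N ≠ 0)
    (B : Set (Fin N → Euc n))
    (hB : ∀ ω ∈ B, (∀ i, ω i ∈ S) → ∀ Q ∈ Dro.PMOn S,
      (∀ j, (Dro.empPM N ω : Measure (Euc n)) (f ⁻¹' {j}) = (Q : Measure (Euc n)) (f ⁻¹' {j})) →
      ENNReal.ofReal r < Dro.klDiv (Q : Measure (Euc n)) (P : Measure (Euc n))) :
    Dro.prodMeas P N B ≤
      ENNReal.ofReal (((N : ℝ) + 1) ^ Fintype.card ι * Real.exp (-(N * r))) := by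
  let B' : (ι → Fin (N + 1)) → Set (Fin N → Euc n) := fun k =>
    {ω | ω ∈ B ∧ (∀ i, ω i ∈ S) ∧ ∀ j, cnt f ω j = (k j : ℕ)}
  have hnull : Dro.prodMeas P N {ω | ¬ ∀ i, ω i ∈ S} = 0 := by
    have hsub : {ω : Fin N → Euc n | ¬ ∀ i, ω i ∈ S} ⊆ ⋃ i : Fin N, (fun ω => ω i) ⁻¹' Sᶜ := by
      intro ω hω
      simp only [mem_ofPred_eq, not_forall] at hω
      exact mem_iUnion.2 hω
    refine measure_mono_null hsub (measure_iUnion_null fun i => ?_)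
    exact (Measure.quasiMeasurePreserving_eval (μ := fun _ : Fin N => (P : Measure (Euc n)))
        i).preimage_null ((prob_compl_eq_zero_iff hS).2 hP)
  have hcov : B ⊆ {ω | ¬ ∀ i, ω i ∈ S} ∪ ⋃ k, B' k := by
    intro ω hω
    by_cases h : ∀ i, ω i ∈ S
    · refine Or.inr (mem_iUnion.2 ⟨fun j => ⟨cnt f ω j, ?_⟩, hω, h, fun j => rfl⟩)
      exact Nat.lt_succ_of_le ((Finset.card_le_univ _).trans (by simp))
    · exact Or.inl h
  calc Dro.prodMeas P N B ≤ 0 + ∑ k, Dro.prodMeas P N (B' k) := by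
        refine (measure_mono hcov).trans ((measure_union_le _ _).trans ?_)
        rw [hnull]
        exact add_le_add le_rfl (measure_iUnion_fintype_le _ _)
    _ ≤ 0 + ∑ _k : ι → Fin (N + 1), ENNReal.ofReal (Real.exp (-(N * r))) := by
        refine add_le_add le_rfl (Finset.sum_le_sum fun k _ => ?_)
        exact type_bound hS f hf P hP r hN (fun j => (k j : ℕ)) (B' k) (fun ω hω => hω.2.2)
          (fun ω hω => hB ω hω.1 hω.2.1)
    _ = _ := by
        rw [zero_add, Finset.sum_const, Finset.card_univ, Fintype.card_fun, Fintype.card_fin,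
          nsmul_eq_mul, ENNReal.ofReal_mul (by positivity), ← ENNReal.ofReal_natCast]
        push_cast
        rfl

theorem rate_upper (P : ProbabilityMeasure (Euc n)) (E : (N : ℕ) → Set (Fin N → Euc n))
    (r : ℝ) (m : ℕ)
    (h : ∀ N, N ≠ 0 → Dro.prodMeas P N (E N) ≤
      ENNReal.ofReal (((N : ℝ) + 1) ^ m * Real.exp (-(N * r)))) :
    Dro.rate P E ≤ ((-r : ℝ) : EReal) := by
  have hlim : Tendsto (fun N : ℕ => (m : ℝ) * (Real.log ((N : ℝ) + 1) / N) - r) atTop (𝓝 (-r)) := by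
    have h1 : Tendsto (fun N : ℕ => Real.log ((N : ℝ) + 1) / N) atTop (𝓝 0) := by
      have a : Tendsto (fun x : ℝ => Real.log x / (x - 1)) atTop (𝓝 0) := by
        have := Real.tendsto_pow_log_div_mul_add_atTop 1 (-1) 1 one_ne_zero
        simpa [sub_eq_add_neg] using this
      have b : Tendsto (fun N : ℕ => (N : ℝ) + 1) atTop atTop :=
        tendsto_atTop_add_const_right _ _ tendsto_natCast_atTop_atTop
      refine (a.comp b).congr fun N => ?_
      simp
    simpa using (h1.const_mul (m : ℝ)).sub_const r
  have hlimE : Tendsto (fun N : ℕ => (((m : ℝ) * (Real.log ((N : ℝ) + 1) / N) - r : ℝ) : EReal))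
      atTop (𝓝 ((-r : ℝ) : EReal)) := (continuous_coe_real_ereal.tendsto _).comp hlim
  rw [Dro.rate, ← hlimE.limsup_eq]
  refine limsup_le_limsup ?_
  filter_upwards [eventually_ne_atTop 0] with N hN
  have hN0 : (0 : ℝ) < N := by positivity
  have h1 : ENNReal.log (Dro.prodMeas P N (E N)) ≤
      ((m * Real.log ((N : ℝ) + 1) - N * r : ℝ) : EReal) := by
    refine (ENNReal.log_monotone (h N hN)).trans ?_
    rw [ENNReal.log_ofReal_of_pos (by positivity), Real.log_mul (by positivity) (by positivity),
      Real.log_pow, Real.log_exp]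
    rfl
  calc _ ≤ (((N : ℝ)⁻¹ : ℝ) : EReal) * ((m * Real.log ((N : ℝ) + 1) - N * r : ℝ) : EReal) :=
        mul_le_mul_of_nonneg_left h1 (by exact_mod_cast (inv_pos.2 hN0).le)
    _ = _ := by
        rw [← EReal.coe_mul]
        congr 1
        field_simp

end Types

theorem cost_le_sSup {n : ℕ} {X : Type*} (S : Set (Euc n)) (hS : IsCompact S)
    (ℓ : X → Euc n → ℝ) (husc : ∀ x, UpperSemicontinuousOn (ℓ x) S)
    (D : ProbabilityMeasure (Euc n) → ProbabilityMeasure (Euc n) → ℝ≥0∞) (η : ℝ≥0∞)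
    (P Ph : ProbabilityMeasure (Euc n)) (hP : P ∈ Dro.PMOn S) (h : D Ph P ≤ η) (x : X) :
    Dro.cost ℓ x P ≤ Dro.cDist D S ℓ η x Ph := by
  obtain ⟨M, hM⟩ := (husc x).bddAbove_of_isCompact hS
  refine le_csSup ⟨max M 0, ?_⟩ ⟨P, hP, h, rfl⟩
  rintro _ ⟨P', hP', -, rfl⟩
  rw [Dro.cost]
  by_cases hi : Integrable (ℓ x) (P' : Measure (Euc n))
  · have hae : ∀ᵐ ξ ∂(P' : Measure (Euc n)), ξ ∈ S :=
      (prob_compl_eq_zero_iff hS.measurableSet).2 hP'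
    calc ∫ ξ, ℓ x ξ ∂(P' : Measure (Euc n)) ≤ ∫ _, max M 0 ∂(P' : Measure (Euc n)) := by
          refine integral_mono_ae hi (integrable_const _) ?_
          filter_upwards [hae] with ξ hξ
          exact (hM (mem_image_of_mem _ hξ)).trans (le_max_left _ _)
      _ = max M 0 := by simp
  · rw [integral_undef hi]; exact le_max_right _ _

end DroAux

open MeasureTheory Set Filter Metric Topology
open scoped ENNReal NNReal
namespace DroAux

theorem unifFeasible_of {n : ℕ} {X : Type*} (S : Set (Euc n)) (hS : IsCompact S)
    (ℓ : X → Euc n → ℝ) (husc : ∀ x, UpperSemicontinuousOn (ℓ x) S)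
    (D : ProbabilityMeasure (Euc n) → ProbabilityMeasure (Euc n) → ℝ≥0∞) (r : ℝ)
    {κ : Type} [Fintype κ] (f : Euc n → (κ → Bool)) (hf : Measurable f)
    (K : ProbabilityMeasure (Euc n) → ProbabilityMeasure (Euc n) → ℝ≥0∞)
    (hK : ∀ Ph ∈ Dro.PMOn S, ∀ Q ∈ Dro.PMOn S,
      (∀ j, (Ph : Measure (Euc n)) (f ⁻¹' {j}) = (Q : Measure (Euc n)) (f ⁻¹' {j})) →
      ∀ P, K Ph P ≤ Dro.klDiv (Q : Measure (Euc n)) (P : Measure (Euc n))) :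
    Dro.UnifFeasible S ℓ (Dro.cDist D S ℓ (sSup {w | ∃ Ph ∈ Dro.PMOn S, ∃ P ∈ Dro.PMOn S,
      K Ph P ≤ ENNReal.ofReal r ∧ w = D Ph P})) r := by
  classical
  intro P hP
  refine rate_upper P _ r (Fintype.card (κ → Bool)) fun N hN => ?_
  refine union_bound hS.measurableSet f hf P hP r hN _ ?_
  intro ω hω hωS Q hQ hcell
  have hemp := emp_mem hS.measurableSet hN ω hωS
  by_contra hc
  obtain ⟨x, hx⟩ := hω
  refine absurd (cost_le_sSup S hS ℓ husc D _ P (Dro.empPM N ω) hP ?_ x) (not_le.2 hx)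
  exact le_sSup ⟨_, hemp, P, hP, (hK _ hemp Q hQ hcell P).trans (not_lt.1 hc), rfl⟩

theorem unifW {n : ℕ} {X : Type*} (S : Set (Euc n)) (hS : IsCompact S)
    (ℓ : X → Euc n → ℝ) (husc : ∀ x, UpperSemicontinuousOn (ℓ x) S)
    (D : ProbabilityMeasure (Euc n) → ProbabilityMeasure (Euc n) → ℝ≥0∞) (r ε : ℝ) (hε : 0 < ε) :
    Dro.UnifFeasible S ℓ (Dro.cDist D S ℓ (Dro.RadW D S ε r)) r := by
  classical
  obtain ⟨κ, _, f, hf, hd⟩ := exists_cells S hS ε hε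
  exact unifFeasible_of S hS ℓ husc D r f hf (Dro.klSmoothW S ε) fun Ph hPh Q hQ h P =>
    iInf₂_le Q ⟨hQ, wdist_le hS.measurableSet ε f hf hd Ph Q hPh h⟩

theorem unifLP {n : ℕ} {X : Type*} (S : Set (Euc n)) (hS : IsCompact S)
    (ℓ : X → Euc n → ℝ) (husc : ∀ x, UpperSemicontinuousOn (ℓ x) S)
    (D : ProbabilityMeasure (Euc n) → ProbabilityMeasure (Euc n) → ℝ≥0∞) (r ε : ℝ) (hε : 0 < ε) :
    Dro.UnifFeasible S ℓ (Dro.cDist D S ℓ (Dro.RadLP D S ε r)) r := by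
  classical
  obtain ⟨κ, _, f, hf, hd⟩ := exists_cells S hS ε hε
  exact unifFeasible_of S hS ℓ husc D r f hf (Dro.klSmoothLP S ε) fun Ph hPh Q hQ h P =>
    iInf₂_le Q ⟨hQ, lpDist_le hS.measurableSet ε hε f hf hd Ph Q hPh hQ h⟩

end DroAux

/-- Corollary: Uniform feasibility of general DRO.
Let `Σ ⊂ ℝ^d` be compact, `ℓ(x,·)` upper semicontinuous on `Σ`, and let `D` be a jointly
convex, lower semicontinuous statistical distance.  Then for every `ε > 0` and `r ≥ 0` the
DRO predictors `ĉ_{D,R^ε_{D,W}(r)}` and `ĉ_{D,R^ε_{D,LP}(r)}` are uniformly feasible at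
rate `r`.  Moreover, if `0 ≤ η < R_D(r)` and `r > 0`, there exists a decision-free
continuous loss for which `ĉ_{D,η}` is not pointwise feasible at rate `r`. -/
theorem general_distance_dro_feasibility
    {n : ℕ} {X : Type*} [Nonempty X]
    (S : Set (Euc n)) (hS : IsCompact S)
    (ℓ : X → Euc n → ℝ) (husc : ∀ x, UpperSemicontinuousOn (ℓ x) S)
    (D : MeasureTheory.ProbabilityMeasure (Euc n) →
          MeasureTheory.ProbabilityMeasure (Euc n) → ℝ≥0∞)
    (hDconv : ∀ t, ∀ ht : t ∈ Set.Icc (0:ℝ) 1, ∀ μ₁ ν₁ μ₂ ν₂,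
      D (Dro.mixPM t ht μ₁ μ₂) (Dro.mixPM t ht ν₁ ν₂)
        ≤ ENNReal.ofReal t * D μ₁ ν₁ + ENNReal.ofReal (1 - t) * D μ₂ ν₂)
    (hDlsc : LowerSemicontinuous fun p : MeasureTheory.ProbabilityMeasure (Euc n) ×
        MeasureTheory.ProbabilityMeasure (Euc n) => D p.1 p.2)
    (r : ℝ) :
    (∀ ε : ℝ, 0 < ε → 0 ≤ r →
      Dro.UnifFeasible S ℓ (Dro.cDist D S ℓ (Dro.RadW D S ε r)) r ∧
      Dro.UnifFeasible S ℓ (Dro.cDist D S ℓ (Dro.RadLP D S ε r)) r) ∧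
    (∀ η : ℝ≥0∞, η < Dro.Rad D S r → 0 < r →
      ∃ ℓ₀ : Euc n → ℝ, ContinuousOn ℓ₀ S ∧
        ¬ Dro.PtFeasible S (fun _ : X => ℓ₀)
            (Dro.cDist D S (fun _ : X => ℓ₀) η) r) := by
  exact ⟨fun ε hε _ => ⟨DroAux.unifW S hS ℓ husc D r ε hε, DroAux.unifLP S hS ℓ husc D r ε hε⟩,
    fun η hη hr => DroAux.not_ptFeasible S hS D hDconv hDlsc r η hη hr⟩
end
end

section
/- Let 0 ≤ ℓ(x,ξ) ≤ ℓ^∞(x) = sup_{ξ∈Σ} ℓ(x,ξ) for all x ∈ X and ξ ∈ Σ. Then for all P̂ ∈ P(Σ), x ∈ X and r ≥ 0, ĉ_{f,r}(x,P̂) equals the supremum of ∫ ℓ(x,ξ) dP_c(ξ) + p_s ℓ^∞(x) over all positive Borel measures P_c on Σ with P_c ≪ P̂ and all p_s ≥ 0 satisfying P_c(Σ) + p_s = 1 and ∫ f(dP_c/dP̂) dP̂ + p_s f^∞ ≤ r. -/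
open MeasureTheory Set Filter Metric Topology
open scoped ENNReal NNReal

set_option linter.unusedSectionVars false

noncomputable section

namespace Dro

variable {Ω : Type*} [MeasurableSpace Ω] [NormedAddCommGroup Ω] [BorelSpace Ω]

open Classical in
/-- The integral `∫ f(dP_c/dP̂) dP̂` (`+∞` if not integrable). -/
def fInt (f : ℝ → ℝ) (Phat Pc : Measure Ω) : EReal :=
  if Integrable (fun ξ => f ((Pc.rnDeriv Phat ξ).toReal)) Phat
  then ((∫ ξ, f ((Pc.rnDeriv Phat ξ).toReal) ∂Phat : ℝ) : EReal) else ⊤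

end Dro

namespace DroAux

open Dro

theorem slope_le_fInfty {f : ℝ → ℝ} (hconv : ConvexOn ℝ (Set.Ici 0) f) {u a : ℝ}
    (hu : 0 ≤ u) (ha : 0 < a) : (((f (u + a) - f u) / a : ℝ) : EReal) ≤ fInfty f := by
  set s := (f (u + a) - f u) / a with hs
  have h1 : Tendsto (fun z : ℝ => s + (f u - s * u) / z) atTop (𝓝 s) := by
    have := (tendsto_const_nhds (x := f u - s * u) (f := (atTop : Filter ℝ))).div_atTop tendsto_id
    simpa using this.const_add s
  have h2 : Tendsto (fun z : ℝ => ((s + (f u - s * u) / z : ℝ) : EReal)) atTop (𝓝 (s : EReal)) :=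
    (continuous_coe_real_ereal.tendsto s).comp h1
  rw [← h2.limsup_eq]
  refine limsup_le_limsup ?_
  filter_upwards [eventually_gt_atTop (u + a)] with z hz
  have hz0 : 0 < z := by linarith
  have h := hconv.secant_mono_aux2 (x := u) (y := u + a) (z := z) hu hz0.le (by linarith) hz
  rw [add_sub_cancel_left, ← hs, le_div_iff₀ (by linarith)] at h
  have : s + (f u - s * u) / z ≤ f z / z := by
    rw [le_div_iff₀ hz0, add_mul, div_mul_cancel₀ _ hz0.ne']
    linarith
  exact_mod_cast this

theorem fInfty_ne_bot {f : ℝ → ℝ} (hconv : ConvexOn ℝ (Set.Ici 0) f) : fInfty f ≠ ⊥ := by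
  have := slope_le_fInfty hconv (u := 0) (a := 1) le_rfl one_pos
  intro h
  rw [h] at this
  exact EReal.coe_ne_bot _ (le_bot_iff.1 this)

theorem fDiv_congr {n : ℕ} (f : ℝ → ℝ) (μ ν : Measure (Euc n)) [IsProbabilityMeasure μ]
    (g : Euc n → ℝ≥0∞) (hg : ν.rnDeriv μ =ᵐ[μ] g)
    (hi : Integrable (fun ξ => f ((g ξ).toReal)) μ) :
    fDiv f μ ν = ((∫ ξ, f ((g ξ).toReal) ∂μ : ℝ) : EReal)
      + fInfty f * (((ν.singularPart μ) Set.univ : ℝ≥0∞) : EReal) := by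
  have h : (fun ξ => f ((ν.rnDeriv μ ξ).toReal)) =ᵐ[μ] (fun ξ => f ((g ξ).toReal)) := by
    filter_upwards [hg] with ξ h
    rw [h]
  rw [fDiv, if_pos (hi.congr h.symm), integral_congr_ae h]

theorem fDiv_add_dirac_le {n : ℕ} {f : ℝ → ℝ} (hconv : ConvexOn ℝ (Set.Ici 0) f)
    (μ Pc : Measure (Euc n)) [IsProbabilityMeasure μ] [IsFiniteMeasure Pc] (hac : Pc ≪ μ)
    {ps r : ℝ} (hps : 0 ≤ ps) (ξ₀ : Euc n)
    (h : fInt f μ Pc + (ps : EReal) * fInfty f ≤ (r : EReal)) :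
    fDiv f μ (Pc + ENNReal.ofReal ps • Measure.dirac ξ₀) ≤ (r : EReal) := by
  have hi : Integrable (fun ξ => f ((Pc.rnDeriv μ ξ).toReal)) μ := by
    by_contra hc
    rw [fInt, if_neg hc, EReal.top_add_of_ne_bot] at h
    · simp at h
    · intro hb
      rcases hps.eq_or_lt with rfl | hpos
      · simp at hb
      · rcases lt_or_ge (fInfty f) 0 with hneg | hnn
        · induction hF : fInfty f with
          | bot => exact fInfty_ne_bot hconv hF
          | top => rw [hF] at hneg; simp at hneg
          | coe F => rw [hF, ← EReal.coe_mul] at hb; exact EReal.coe_ne_bot _ hb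
        · have := mul_nonneg (EReal.coe_nonneg.2 hps) hnn
          rw [hb] at this
          simp at this
  rw [fInt, if_pos hi] at h
  have : Pc.HaveLebesgueDecomposition μ := Measure.haveLebesgueDecomposition_of_sigmaFinite _ _
  have hdec : μ.withDensity (Pc.rnDeriv μ) = Pc := Measure.withDensity_rnDeriv_eq _ _ hac
  rcases hps.eq_or_lt with rfl | hpos
  · simp only [ENNReal.ofReal_zero, zero_smul, add_zero]
    rw [fDiv_congr f μ Pc _ (ae_eq_refl _) hi, Measure.singularPart_eq_zero_of_ac hac]
    simpa using h
  by_cases hat : μ {ξ₀} = 0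
  · have hsing : (ENNReal.ofReal ps • Measure.dirac ξ₀ : Measure (Euc n)) ⟂ₘ μ := by
      refine Measure.MutuallySingular.smul _ ?_
      refine ⟨{ξ₀}ᶜ, (measurableSet_singleton _).compl, ?_, ?_⟩ <;> simp [hat]
    have hadd : Pc + ENNReal.ofReal ps • Measure.dirac ξ₀
        = ENNReal.ofReal ps • Measure.dirac ξ₀ + μ.withDensity (Pc.rnDeriv μ) := by
      rw [hdec, add_comm]
    rw [fDiv_congr f μ _ _ (Measure.eq_rnDeriv (Measure.measurable_rnDeriv _ _) hsing hadd).symm hi,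
      ← Measure.eq_singularPart (Measure.measurable_rnDeriv _ _) hsing hadd]
    simp only [Measure.smul_apply, measure_univ, smul_eq_mul, mul_one, EReal.coe_ennreal_ofReal,
      max_eq_left hps]
    rwa [mul_comm]
  have hfin : μ {ξ₀} ≠ ⊤ := measure_ne_top _ _
  have hm : 0 < μ.real {ξ₀} := ENNReal.toReal_pos hat hfin
  set a : ℝ := ps / μ.real {ξ₀} with ha
  have hapos : 0 < a := div_pos hpos hm
  have hmul : μ.real {ξ₀} * a = ps := by rw [ha]; field_simp
  -- density
  set g : Euc n → ℝ≥0∞ := Pc.rnDeriv μ + Set.indicator {ξ₀} (fun _ => ENNReal.ofReal a) with hgdef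
  have hgm : Measurable g :=
    (Measure.measurable_rnDeriv _ _).add (measurable_const.indicator (measurableSet_singleton _))
  have hPd : Pc + ENNReal.ofReal ps • Measure.dirac ξ₀ = 0 + μ.withDensity g := by
    rw [zero_add, hgdef, withDensity_add_left (Measure.measurable_rnDeriv _ _), hdec,
      withDensity_indicator (measurableSet_singleton _), withDensity_const,
      Measure.restrict_singleton, smul_smul, ← hmul, ENNReal.ofReal_mul hm.le,
      measureReal_def, ENNReal.ofReal_toReal hfin, mul_comm]
  have hz : (0 : Measure (Euc n)) ⟂ₘ μ := Measure.MutuallySingular.zero_left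
  have hg : (Pc + ENNReal.ofReal ps • Measure.dirac ξ₀).rnDeriv μ =ᵐ[μ] g :=
    (Measure.eq_rnDeriv hgm hz hPd).symm
  set b : ℝ := f ((Pc.rnDeriv μ ξ₀).toReal + a) - f ((Pc.rnDeriv μ ξ₀).toReal) with hb
  have hfg : (fun ξ => f ((Pc.rnDeriv μ ξ).toReal) + Set.indicator {ξ₀} (fun _ => b) ξ)
      =ᵐ[μ] (fun ξ => f ((g ξ).toReal)) := by
    filter_upwards [Measure.rnDeriv_lt_top Pc μ] with ξ hξ
    by_cases hx : ξ = ξ₀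
    · subst hx
      simp [hgdef, hb, ENNReal.toReal_add hξ.ne, ENNReal.toReal_ofReal hapos.le]
    · simp [hgdef, hx]
  have hi2 : Integrable (Set.indicator {ξ₀} (fun _ => b)) μ :=
    (integrable_const b).indicator (measurableSet_singleton _)
  rw [fDiv_congr f μ _ g hg ((hi.add hi2).congr hfg), ← integral_congr_ae hfg, integral_add hi hi2,
    integral_indicator_const _ (measurableSet_singleton _), ← Measure.eq_singularPart hgm hz hPd]
  simp only [Measure.coe_zero, Pi.zero_apply, EReal.coe_ennreal_zero, mul_zero, add_zero,
    smul_eq_mul]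
  have hsl := slope_le_fInfty hconv (u := (Pc.rnDeriv μ ξ₀).toReal) ENNReal.toReal_nonneg hapos
  rw [← hb] at hsl
  induction hF : fInfty f with
  | bot => exact absurd hF (fInfty_ne_bot hconv)
  | top =>
    rw [hF, EReal.coe_mul_top_of_pos hpos, EReal.coe_add_top] at h
    simp at h
  | coe F =>
    rw [hF] at h hsl
    have hsl' : b / a ≤ F := by exact_mod_cast hsl
    rw [div_le_iff₀ hapos] at hsl'
    have h' : (∫ ξ, f ((Pc.rnDeriv μ ξ).toReal) ∂μ) + ps * F ≤ r := by exact_mod_cast h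
    have : μ.real {ξ₀} * b ≤ ps * F := by
      calc μ.real {ξ₀} * b ≤ μ.real {ξ₀} * (F * a) := by gcongr
        _ = ps * F := by rw [← hmul]; ring
    exact_mod_cast (by linarith : (∫ ξ, f ((Pc.rnDeriv μ ξ).toReal) ∂μ) + μ.real {ξ₀} * b ≤ r)

theorem integrable_of_bdd {n : ℕ} {S : Set (Euc n)} {g : Euc n → ℝ} (hg : Measurable g)
    (h0 : ∀ ξ ∈ S, 0 ≤ g ξ) (hb : BddAbove (g '' S)) (ν : Measure (Euc n)) [IsFiniteMeasure ν]
    (hν : ∀ᵐ ξ ∂ν, ξ ∈ S) :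
    Integrable g ν ∧ ∫ ξ, g ξ ∂ν ≤ ν.real Set.univ * sSup (g '' S) := by
  have hint : Integrable g ν := by
    refine Integrable.of_bound hg.aestronglyMeasurable (sSup (g '' S)) ?_
    filter_upwards [hν] with ξ hξ
    rw [Real.norm_of_nonneg (h0 ξ hξ)]
    exact le_csSup hb (Set.mem_image_of_mem _ hξ)
  refine ⟨hint, ?_⟩
  calc ∫ ξ, g ξ ∂ν ≤ ∫ _, sSup (g '' S) ∂ν := by
        refine integral_mono_ae hint (integrable_const _) ?_
        filter_upwards [hν] with ξ hξ
        exact le_csSup hb (Set.mem_image_of_mem _ hξ)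
    _ = _ := by simp

end DroAux

open MeasureTheory in
/-- Lemma: continuous-singular decomposition of `f`-divergence DRO.
Let `0 ≤ ℓ(x,ξ) ≤ ℓ^∞(x) = sup_{ξ∈Σ} ℓ(x,ξ)`.  Then for all `P̂ ∈ P(Σ)`, `x ∈ X` and
`r ≥ 0`, `ĉ_{f,r}(x,P̂)` equals the supremum of `∫ ℓ(x,ξ) dP_c + p_s ℓ^∞(x)` over positive
measures `P_c ≪ P̂` and reals `p_s ≥ 0` with `P_c(Σ) + p_s = 1` and
`∫ f(dP_c/dP̂) dP̂ + p_s f^∞ ≤ r`. -/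
theorem fdiv_dro_continuous_singular_decomposition
    {n : ℕ} {X : Type*} [Nonempty X]
    (S : Set (Euc n)) (hS : IsCompact S)
    (f : ℝ → ℝ) (hconv : ConvexOn ℝ (Set.Ici 0) f)
    (hlsc : LowerSemicontinuousOn f (Set.Ici 0)) (hf1 : f 1 = 0)
    (ℓ : X → Euc n → ℝ) (hmeas : ∀ x, Measurable (ℓ x))
    (h0 : ∀ x, ∀ ξ ∈ S, 0 ≤ ℓ x ξ) (hbdd : ∀ x, BddAbove (ℓ x '' S))
    (r : ℝ) (hr : 0 ≤ r) (x : X) (Phat : ProbabilityMeasure (Euc n))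
    (hPhat : Phat ∈ Dro.PMOn S) :
    Dro.cF f S ℓ r x Phat
      = sSup {v | ∃ (Pc : Measure (Euc n)) (ps : ℝ),
          Pc ≪ (Phat : Measure (Euc n)) ∧ 0 ≤ ps ∧
          Pc Set.univ + ENNReal.ofReal ps = 1 ∧
          Dro.fInt f (Phat : Measure (Euc n)) Pc + (ps : EReal) * Dro.fInfty f ≤ (r : EReal) ∧
          v = (∫ ξ, ℓ x ξ ∂Pc) + ps * sSup (ℓ x '' S)} := by
  set μ : Measure (Euc n) := (Phat : Measure (Euc n)) with hμ
  have hSm : MeasurableSet S := hS.measurableSet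
  have hμS : ∀ᵐ ξ ∂μ, ξ ∈ S := by
    have hPX : μ S = 1 := hPhat
    rw [← mem_ae_iff_prob_eq_one hSm] at hPX
    exact hPX
  set L := sSup (ℓ x '' S) with hL
  have hSne : S.Nonempty := by
    obtain ⟨ξ, hξ⟩ := hμS.exists
    exact ⟨ξ, hξ⟩
  -- values of the right-hand problem are at most `L`
  have hub : ∀ (Pc : Measure (Euc n)) (ps : ℝ), Pc ≪ μ → 0 ≤ ps →
      Pc Set.univ + ENNReal.ofReal ps = 1 → (∫ ξ, ℓ x ξ ∂Pc) + ps * L ≤ L := by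
    intro Pc ps hac hps hsum
    have : IsFiniteMeasure Pc := ⟨lt_of_le_of_lt (le_self_add.trans hsum.le) ENNReal.one_lt_top⟩
    have h1 := (DroAux.integrable_of_bdd (hmeas x) (h0 x) (hbdd x) Pc (hac.ae_le hμS)).2
    have h2 : Pc.real Set.univ + ps = 1 := by
      have := congrArg ENNReal.toReal hsum
      rwa [ENNReal.toReal_add (measure_ne_top _ _) ENNReal.ofReal_ne_top,
        ENNReal.toReal_ofReal hps, ENNReal.toReal_one] at this
    calc _ ≤ Pc.real Set.univ * L + ps * L := by gcongr
      _ = L := by rw [← add_mul, h2, one_mul]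
  -- left values are dominated by right values
  have hLR : ∀ P ∈ Dro.PMOn S, Dro.fDiv f μ (P : Measure (Euc n)) ≤ (r : EReal) →
      ∃ (Pc : Measure (Euc n)) (ps : ℝ), (Pc ≪ μ ∧ 0 ≤ ps ∧ Pc Set.univ + ENNReal.ofReal ps = 1 ∧
        Dro.fInt f μ Pc + (ps : EReal) * Dro.fInfty f ≤ (r : EReal)) ∧
        Dro.cost ℓ x P ≤ (∫ ξ, ℓ x ξ ∂Pc) + ps * L := by
    intro P hP hdiv
    set ν : Measure (Euc n) := (P : Measure (Euc n)) with hν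
    have hνS : ∀ᵐ ξ ∂ν, ξ ∈ S := by
      have hPX : ν S = 1 := hP
      rw [← mem_ae_iff_prob_eq_one hSm] at hPX
      exact hPX
    have : ν.HaveLebesgueDecomposition μ := Measure.haveLebesgueDecomposition_of_sigmaFinite _ _
    have hdec : μ.withDensity (ν.rnDeriv μ) + ν.singularPart μ = ν :=
      Measure.rnDeriv_add_singularPart _ _
    have hsfin : (ν.singularPart μ) Set.univ ≠ ⊤ := measure_ne_top _ _
    refine ⟨μ.withDensity (ν.rnDeriv μ), (ν.singularPart μ).real Set.univ,
      ⟨withDensity_absolutelyContinuous _ _, measureReal_nonneg, ?_, ?_⟩, ?_⟩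
    · rw [measureReal_def, ENNReal.ofReal_toReal hsfin, ← Measure.add_apply, hdec]
      exact measure_univ
    · have hrn := Measure.rnDeriv_withDensity μ (Measure.measurable_rnDeriv ν μ)
      have hcong : (fun ξ => f (((μ.withDensity (ν.rnDeriv μ)).rnDeriv μ ξ).toReal))
          =ᵐ[μ] (fun ξ => f ((ν.rnDeriv μ ξ).toReal)) := by
        filter_upwards [hrn] with ξ h
        rw [h]
      by_cases hi : Integrable (fun ξ => f ((ν.rnDeriv μ ξ).toReal)) μ
      · rw [Dro.fDiv, if_pos hi] at hdiv
        rw [Dro.fInt, if_pos (hi.congr hcong.symm), integral_congr_ae hcong, mul_comm,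
          measureReal_def, EReal.coe_ennreal_toReal hsfin]
        exact hdiv
      · rw [Dro.fDiv, if_neg hi] at hdiv
        simp at hdiv
    · have hle1 : μ.withDensity (ν.rnDeriv μ) ≤ ν := Measure.withDensity_rnDeriv_le _ _
      have hle2 : ν.singularPart μ ≤ ν := Measure.singularPart_le _ _
      have hs1 : ∀ᵐ ξ ∂(μ.withDensity (ν.rnDeriv μ)), ξ ∈ S := ae_mono hle1 hνS
      have hs2 : ∀ᵐ ξ ∂(ν.singularPart μ), ξ ∈ S := ae_mono hle2 hνS
      have i1 := DroAux.integrable_of_bdd (hmeas x) (h0 x) (hbdd x) _ hs1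
      have i2 := DroAux.integrable_of_bdd (hmeas x) (h0 x) (hbdd x) _ hs2
      have : Dro.cost ℓ x P = (∫ ξ, ℓ x ξ ∂(μ.withDensity (ν.rnDeriv μ)))
          + ∫ ξ, ℓ x ξ ∂(ν.singularPart μ) := by
        rw [← integral_add_measure i1.1 i2.1, hdec]
        rfl
      rw [this]
      linarith [i2.2]
  -- the reference measure is feasible on the left
  have hfeas : Dro.fDiv f μ μ ≤ (r : EReal) := by
    have h1 : (fun ξ => f (((1 : Euc n → ℝ≥0∞) ξ).toReal)) = fun _ => 0 := by
      ext ξ; simp [hf1]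
    have hi : Integrable (fun ξ => f (((1 : Euc n → ℝ≥0∞) ξ).toReal)) μ := by
      rw [h1]; exact integrable_zero _ _ _
    rw [DroAux.fDiv_congr f μ μ 1 (Measure.rnDeriv_self μ) hi, h1,
      Measure.singularPart_eq_zero_of_ac Measure.AbsolutelyContinuous.rfl]
    simpa using hr
  have hbR : BddAbove {v | ∃ (Pc : Measure (Euc n)) (ps : ℝ),
          Pc ≪ μ ∧ 0 ≤ ps ∧ Pc Set.univ + ENNReal.ofReal ps = 1 ∧
          Dro.fInt f μ Pc + (ps : EReal) * Dro.fInfty f ≤ (r : EReal) ∧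
          v = (∫ ξ, ℓ x ξ ∂Pc) + ps * L} := by
    refine ⟨L, ?_⟩
    rintro v ⟨Pc, ps, hac, hps, hsum, -, rfl⟩
    exact hub Pc ps hac hps hsum
  have hbL : BddAbove {v | ∃ P ∈ Dro.PMOn S,
      Dro.fDiv f μ (P : Measure (Euc n)) ≤ (r : EReal) ∧ v = Dro.cost ℓ x P} := by
    refine ⟨L, ?_⟩
    rintro v ⟨P, hP, hd, rfl⟩
    obtain ⟨Pc, ps, ⟨hac, hps, hsum, -⟩, hle⟩ := hLR P hP hd
    exact hle.trans (hub Pc ps hac hps hsum)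
  unfold Dro.cF
  apply le_antisymm
  · refine csSup_le ⟨_, Phat, hPhat, hfeas, rfl⟩ ?_
    rintro v ⟨P, hP, hd, rfl⟩
    obtain ⟨Pc, ps, ⟨hac, hps, hsum, hc⟩, hle⟩ := hLR P hP hd
    exact hle.trans (le_csSup hbR ⟨Pc, ps, hac, hps, hsum, hc, rfl⟩)
  · obtain ⟨Pc₀, ps₀, ⟨hac₀, hps₀, hsum₀, hc₀⟩, -⟩ := hLR Phat hPhat hfeas
    refine csSup_le ⟨_, Pc₀, ps₀, hac₀, hps₀, hsum₀, hc₀, rfl⟩ ?_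
    rintro v ⟨Pc, ps, hac, hps, hsum, hc, rfl⟩
    have : IsFiniteMeasure Pc := ⟨lt_of_le_of_lt (le_self_add.trans hsum.le) ENNReal.one_lt_top⟩
    have hPcS := hac.ae_le hμS
    have i1 := DroAux.integrable_of_bdd (hmeas x) (h0 x) (hbdd x) Pc hPcS
    have hps1 : ps ≤ 1 := by
      have : ENNReal.ofReal ps ≤ 1 := hsum ▸ le_add_self
      simpa using this
    refine le_of_forall_pos_sub_le fun ε hε => ?_
    obtain ⟨_, ⟨ξ₀, hξ₀, rfl⟩, hlt⟩ := exists_lt_of_lt_csSup (hSne.image (ℓ x))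
      (show L - ε < sSup (ℓ x '' S) by rw [← hL]; linarith)
    set ν : Measure (Euc n) := Pc + ENNReal.ofReal ps • Measure.dirac ξ₀ with hνdef
    have hprob : IsProbabilityMeasure ν := ⟨by simpa [hνdef] using hsum⟩
    have hPS : (⟨ν, hprob⟩ : ProbabilityMeasure (Euc n)) ∈ Dro.PMOn S := by
      change ν S = 1
      rw [← prob_compl_eq_zero_iff hSm]
      have h1 : Pc Sᶜ = 0 := hPcS
      simp [hνdef, h1, hξ₀, hSm]
    have hd : Dro.fDiv f μ ν ≤ (r : EReal) := DroAux.fDiv_add_dirac_le hconv μ Pc hac hps ξ₀ hc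
    have hcost : Dro.cost ℓ x ⟨ν, hprob⟩ = (∫ ξ, ℓ x ξ ∂Pc) + ps * ℓ x ξ₀ := by
      change ∫ ξ, ℓ x ξ ∂ν = _
      have i2 : Integrable (ℓ x) (ENNReal.ofReal ps • Measure.dirac ξ₀) :=
        (integrable_dirac (by simp)).smul_measure ENNReal.ofReal_ne_top
      rw [hνdef, integral_add_measure i1.1 i2, integral_smul_measure, integral_dirac,
        ENNReal.toReal_ofReal hps, smul_eq_mul]
    refine le_trans ?_ (le_csSup hbL ⟨⟨ν, hprob⟩, hPS, hd, rfl⟩)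
    rw [hcost]
    nlinarith [mul_nonneg hps (sub_nonneg.2 hlt.le), mul_nonneg hε.le (sub_nonneg.2 hps1)]
end
end
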